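/- arXiv:1311.3048 — 2 statements merged into one kernel-verified Lean document; each statement's English description precedes it below -/
import Mathlib

section
/- There is a universal constant C such that the following holds. Let r ≥ 1, let G = (V,E) be a finite edge-weighted graph of treewidth at most r − 1, and let Δ > 0. Then there is a probability distribution over partitions of V into clusters each of strong diameter at most Δ such that for every vertex z ∈ V and every 0 ≤ γ ≤ 1/r, the probability that the ball B_G(z, γΔ) is cut by the partition (i.e., not contained in a single cluster) is at most C·γr. -/
open MeasureTheory Real ENNReal

namespace KPRpaper

variable {V : Type*}

/-- The total weight of a walk in an edge-weighted graph. -/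
def walkWeight (w : V → V → ℝ) {G : SimpleGraph V} {x y : V} (p : G.Walk x y) : ℝ :=
  (p.darts.map (fun d => w d.toProd.1 d.toProd.2)).sum

/-- Shortest-path distance between `x` and `y` using only walks whose vertices all
lie in the set `s` (`⊤` if there is no such walk). -/
noncomputable def dIn (G : SimpleGraph V) (w : V → V → ℝ) (s : Set V) (x y : V) : ℝ≥0∞ :=
  ⨅ p : {p : G.Walk x y // ∀ v ∈ p.support, v ∈ s}, ENNReal.ofReal (walkWeight w p.1)

/-- Shortest-path distance in the whole graph. -/
noncomputable def dG (G : SimpleGraph V) (w : V → V → ℝ) (x y : V) : ℝ≥0∞ :=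
  dIn G w Set.univ x y

/-- Distance from a point to a set, within the vertex set `s`. -/
noncomputable def dSet (G : SimpleGraph V) (w : V → V → ℝ) (s : Set V) (x : V) (A : Set V) :
    ℝ≥0∞ :=
  ⨅ a ∈ A, dIn G w s x a

/-- The ball of radius `ρ` around `z` in the shortest-path metric. -/
def gball (G : SimpleGraph V) (w : V → V → ℝ) (z : V) (ρ : ℝ) : Set V :=
  {v | dG G w z v ≤ ENNReal.ofReal ρ}

/-- The ball of radius `ρ` around the set `A`, inside the induced subgraph on `s`. -/
def gballIn (G : SimpleGraph V) (w : V → V → ℝ) (s A : Set V) (ρ : ℝ) : Set V :=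
  {v | v ∈ s ∧ dSet G w s v A ≤ ENNReal.ofReal ρ}

/-- `G` contains the complete graph `K_q` as a minor: there are `q` pairwise disjoint
nonempty vertex sets, each inducing a connected subgraph, with an edge between any two. -/
def HasCliqueMinor (G : SimpleGraph V) (q : ℕ) : Prop :=
  ∃ S : Fin q → Set V,
    (∀ i, (S i).Nonempty) ∧
    (∀ i, (G.induce (S i)).Connected) ∧
    (∀ i j, i ≠ j → Disjoint (S i) (S j)) ∧
    (∀ i j, i ≠ j → ∃ u ∈ S i, ∃ v ∈ S j, G.Adj u v)

/-- There is a walk from `x` to `y` all of whose vertices lie in `s`. -/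
def ReachableIn (G : SimpleGraph V) (s : Set V) (x y : V) : Prop :=
  ∃ p : G.Walk x y, ∀ v ∈ p.support, v ∈ s


/-- `(T, X)` is a tree decomposition of `G`: `T` is a finite tree, the bags `X i` cover
all vertices, every edge of `G` lies in some bag, and for each vertex the set of bags
containing it induces a connected subtree of `T`. -/
def IsTreeDecomp {I : Type*} (G : SimpleGraph V) (T : SimpleGraph I) (X : I → Set V) :
    Prop :=
  T.IsTree ∧
  (∀ v : V, ∃ i, v ∈ X i) ∧
  (∀ u v : V, G.Adj u v → ∃ i, u ∈ X i ∧ v ∈ X i) ∧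
  (∀ (v : V) (i j : I), v ∈ X i → v ∈ X j → ReachableIn T {k | v ∈ X k} i j)

/-- `G` has treewidth at most `k`: it has a tree decomposition all of whose bags have
at most `k + 1` vertices. -/
def TreewidthAtMost (G : SimpleGraph V) (k : ℕ) : Prop :=
  ∃ (I : Type) (_ : Fintype I) (T : SimpleGraph I) (X : I → Set V),
    IsTreeDecomp G T X ∧ ∀ i, (X i).ncard ≤ k + 1

section Walks

variable {G : SimpleGraph V} {w : V → V → ℝ}

@[simp] lemma walkWeight_nil (x : V) : walkWeight w (SimpleGraph.Walk.nil : G.Walk x x) = 0 := by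
  simp [walkWeight]

@[simp] lemma walkWeight_cons {x y z : V} (h : G.Adj x y) (p : G.Walk y z) :
    walkWeight w (SimpleGraph.Walk.cons h p) = w x y + walkWeight w p := by
  simp [walkWeight]

lemma walkWeight_append {x y z : V} (p : G.Walk x y) (q : G.Walk y z) :
    walkWeight w (p.append q) = walkWeight w p + walkWeight w q := by
  simp [walkWeight]

lemma walkWeight_reverse (hsymm : ∀ u v, w u v = w v u) {x y : V} (p : G.Walk x y) :
    walkWeight w p.reverse = walkWeight w p := by
  induction p with
  | nil => simp
  | cons h p ih =>
    rw [SimpleGraph.Walk.reverse_cons, walkWeight_append, ih]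
    simp [hsymm, add_comm]

lemma walkWeight_nonneg (hpos : ∀ u v, G.Adj u v → 0 < w u v) {x y : V} (p : G.Walk x y) :
    0 ≤ walkWeight w p := by
  induction p with
  | nil => simp
  | cons h p ih => rw [walkWeight_cons]; linarith [hpos _ _ h]

/-- There is a walk of weight at most `l` from `x` to `y` all of whose vertices lie in `U`. -/
def ReachWithin (G : SimpleGraph V) (w : V → V → ℝ) (U : Set V) (l : ℝ) (x y : V) : Prop :=
  ∃ p : G.Walk x y, (∀ v ∈ p.support, v ∈ U) ∧ walkWeight w p ≤ l

/-- The ball of radius `R` around `v` in the subgraph induced on `U`. -/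
def cluster (G : SimpleGraph V) (w : V → V → ℝ) (U : Set V) (v : V) (R : ℝ) : Set V :=
  {x | ReachWithin G w U R v x}

namespace ReachWithin

variable {U U' : Set V} {l l' : ℝ} {x y z : V}

lemma left_mem (h : ReachWithin G w U l x y) : x ∈ U := by
  obtain ⟨p, hp, -⟩ := h; exact hp _ p.start_mem_support

lemma right_mem (h : ReachWithin G w U l x y) : y ∈ U := by
  obtain ⟨p, hp, -⟩ := h; exact hp _ p.end_mem_support

lemma refl (hx : x ∈ U) (hl : 0 ≤ l) : ReachWithin G w U l x x :=
  ⟨.nil, by simpa using hx, by simpa using hl⟩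

lemma mono (h : ReachWithin G w U l x y) (hU : U ⊆ U') (hl : l ≤ l') :
    ReachWithin G w U' l' x y := by
  obtain ⟨p, hp, hw⟩ := h
  exact ⟨p, fun v hv => hU (hp v hv), hw.trans hl⟩

lemma trans (h : ReachWithin G w U l x y) (h' : ReachWithin G w U l' y z) :
    ReachWithin G w U (l + l') x z := by
  obtain ⟨p, hp, hw⟩ := h
  obtain ⟨q, hq, hw'⟩ := h'
  refine ⟨p.append q, fun v hv => ?_, by rw [walkWeight_append]; linarith⟩
  rcases SimpleGraph.Walk.mem_support_append_iff _ _ |>.1 hv with h | h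
  exacts [hp v h, hq v h]

lemma symm (hsymm : ∀ u v, w u v = w v u) (h : ReachWithin G w U l x y) :
    ReachWithin G w U l y x := by
  obtain ⟨p, hp, hw⟩ := h
  exact ⟨p.reverse, fun v hv => hp v (by simpa using hv), by rwa [walkWeight_reverse hsymm]⟩

lemma nonneg (hpos : ∀ u v, G.Adj u v → 0 < w u v) (h : ReachWithin G w U l x y) : 0 ≤ l := by
  obtain ⟨p, -, hw⟩ := h
  exact (walkWeight_nonneg hpos p).trans hw

lemma dIn_le (h : ReachWithin G w U l x y) : dIn G w U x y ≤ ENNReal.ofReal l := by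
  obtain ⟨p, hp, hw⟩ := h
  exact (iInf_le _ ⟨p, hp⟩).trans (ENNReal.ofReal_le_ofReal hw)

/-- Splitting a walk at a vertex of its support. -/
lemma split (p : G.Walk x y) (hp : ∀ v ∈ p.support, v ∈ U) (hz : z ∈ p.support) :
    ∃ l₁ l₂, l₁ + l₂ = walkWeight w p ∧ ReachWithin G w U l₁ x z ∧ ReachWithin G w U l₂ z y := by
  classical
  refine ⟨walkWeight w (p.takeUntil z hz), walkWeight w (p.dropUntil z hz), ?_,
    ⟨_, fun v hv => hp v (p.support_takeUntil_subset_support hz hv), le_rfl⟩,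
    ⟨_, fun v hv => hp v (p.support_dropUntil_subset_support hz hv), le_rfl⟩⟩
  rw [← walkWeight_append, SimpleGraph.Walk.take_spec]

/-- A bounded walk stays inside the ball around its starting point. -/
lemma in_cluster (hpos : ∀ u v, G.Adj u v → 0 < w u v) (h : ReachWithin G w U l x y) :
    ReachWithin G w (cluster G w U x l) l x y := by
  obtain ⟨p, hp, hw⟩ := h
  refine ⟨p, fun v hv => ?_, hw⟩
  obtain ⟨l₁, l₂, hl, h₁, h₂⟩ := split (w := w) p hp hv
  exact h₁.mono subset_rfl (by linarith [h₂.nonneg hpos])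

/-- A walk that meets `S` and ends outside `S` leaves `S` for the last time somewhere. -/
lemma exists_last_exit {S : Set V} (p : G.Walk x z) (hp : ∀ v ∈ p.support, v ∈ U) (hz : z ∉ S)
    (hS : ∃ c ∈ p.support, c ∈ S) :
    ∃ b ∈ S, ∃ u, u ∉ S ∧ G.Adj b u ∧ ∃ l₁ l₂, l₁ + l₂ = walkWeight w p ∧
      ReachWithin G w U l₁ x u ∧ ReachWithin G w (U \ S) l₂ u z := by
  induction p with
  | nil =>
    obtain ⟨c, hc, hcS⟩ := hS
    simp only [SimpleGraph.Walk.support_nil, List.mem_singleton] at hc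
    exact absurd (hc ▸ hcS) hz
  | @cons a b c h p ih =>
    have hpU : ∀ v ∈ p.support, v ∈ U := fun v hv => hp v (by simp [hv])
    have haU : a ∈ U := hp a (by simp)
    by_cases hS' : ∃ c ∈ p.support, c ∈ S
    · obtain ⟨b', hb', u, hu, hadj, l₁, l₂, hl, h₁, h₂⟩ := ih hpU hz hS'
      refine ⟨b', hb', u, hu, hadj, w a b + l₁, l₂, by rw [walkWeight_cons]; linarith, ?_, h₂⟩
      refine ReachWithin.trans ⟨.cons h .nil, ?_, by simp⟩ h₁
      intro v hv
      simp only [SimpleGraph.Walk.support_cons, SimpleGraph.Walk.support_nil, List.mem_cons,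
        List.not_mem_nil, or_false] at hv
      rcases hv with rfl | rfl
      exacts [haU, hpU _ p.start_mem_support]
    · push Not at hS'
      have ha : a ∈ S := by
        obtain ⟨c, hc, hcS⟩ := hS
        rw [SimpleGraph.Walk.support_cons, List.mem_cons] at hc
        rcases hc with rfl | hc
        exacts [hcS, absurd hcS (hS' c hc)]
      refine ⟨a, ha, b, hS' b p.start_mem_support, h, w a b, walkWeight w p, by simp,
        ⟨.cons h .nil, ?_, by simp⟩, ⟨p, fun v hv => ⟨hpU v hv, hS' v hv⟩, le_rfl⟩⟩
      intro v hv
      simp only [SimpleGraph.Walk.support_cons, SimpleGraph.Walk.support_nil, List.mem_cons,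
        List.not_mem_nil, or_false] at hv
      rcases hv with rfl | rfl
      exacts [haU, hpU _ p.start_mem_support]

/-- After removing a ball of radius `R` around `v`, the part of a walk from `v` to `z` behind the
ball is shorter by `R`. -/
lemma residual {v : V} {R : ℝ} (hR : 0 ≤ R) (h : ReachWithin G w U l v z)
    (hz : z ∉ cluster G w U v R) :
    ∃ b ∈ cluster G w U v R, ∃ u ∈ U \ cluster G w U v R, G.Adj b u ∧
      ReachWithin G w (U \ cluster G w U v R) (l - R) u z := by
  have hv : v ∈ cluster G w U v R := ReachWithin.refl h.left_mem hR
  obtain ⟨p, hp, hw⟩ := h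
  obtain ⟨b, hb, u, hu, hadj, l₁, l₂, hl, h₁, h₂⟩ :=
    exists_last_exit (w := w) p hp hz ⟨v, p.start_mem_support, hv⟩
  refine ⟨b, hb, u, h₂.left_mem, hadj, h₂.mono subset_rfl ?_⟩
  have : R < l₁ := by
    by_contra! hle
    exact hu (h₁.mono subset_rfl hle)
  linarith

end ReachWithin

lemma cluster_subset (U : Set V) (v : V) (R : ℝ) : cluster G w U v R ⊆ U :=
  fun _ hx => hx.right_mem

lemma cluster_mono (U : Set V) (v : V) {R R' : ℝ} (h : R ≤ R') :
    cluster G w U v R ⊆ cluster G w U v R' :=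
  fun _ hx => ReachWithin.mono hx subset_rfl h

lemma reachWithin_of_dIn_lt {U : Set V} {x y : V} {l : ℝ}
    (h : dIn G w U x y < ENNReal.ofReal l) : ∃ l' < l, ReachWithin G w U l' x y := by
  obtain ⟨⟨p, hp⟩, hlt⟩ := iInf_lt_iff.1 h
  exact ⟨_, (ENNReal.ofReal_lt_ofReal_iff'.1 hlt).1, p, hp, le_rfl⟩

end Walks

section EliminationOrder

variable {I : Type*} {T : SimpleGraph I}

lemma parent_unique (hT : T.IsTree) {a i j j' : I} (hj : T.Adj i j) (hj' : T.Adj i j')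
    (h : T.dist a i = T.dist a j + 1) (h' : T.dist a i = T.dist a j' + 1) : j = j' := by
  obtain ⟨p, hp⟩ := hT.1.exists_walk_length_eq_dist a j
  obtain ⟨p', hp'⟩ := hT.1.exists_walk_length_eq_dist a j'
  have h₁ : (p.concat hj.symm).IsPath :=
    SimpleGraph.Walk.isPath_of_length_eq_dist _ (by simp [hp, h])
  have h₂ : (p'.concat hj'.symm).IsPath :=
    SimpleGraph.Walk.isPath_of_length_eq_dist _ (by simp [hp', h'])
  have := (hT.2.subsingleton_path _ _).elim ⟨_, h₁⟩ ⟨_, h₂⟩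
  have := congrArg SimpleGraph.Walk.penultimate (congrArg Subtype.val this)
  simpa using this

lemma boundary_of_descendants (hT : T.IsTree) {a t i j : I}
    (hi : T.dist a i = T.dist a t + T.dist t i) (hj : T.dist a j ≠ T.dist a t + T.dist t j)
    (hadj : T.Adj i j) : i = t ∧ T.dist a j < T.dist a t := by
  have tri := hT.1.dist_triangle (u := a) (v := t) (w := j)
  have tri' := hT.1.dist_triangle (u := t) (v := i) (w := j)
  have h1 : T.dist i j = 1 := SimpleGraph.dist_eq_one_iff_adj.2 hadj
  rcases hT.dist_eq_dist_add_one_of_adj a hadj with h | h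
  · rcases hd : T.dist t i with _ | m
    · have : t = i := hT.1.dist_eq_zero_iff.1 hd
      subst this
      exact ⟨rfl, by omega⟩
    · exfalso
      obtain ⟨p, hp⟩ := hT.1.exists_walk_length_eq_dist i t
      rw [SimpleGraph.dist_comm, hd] at hp
      cases p with
      | nil => simp at hp
      | @cons _ j' _ hadj' p =>
        have hm : T.dist t j' ≤ m := by
          have := SimpleGraph.dist_le p
          rw [SimpleGraph.dist_comm] at this
          simp only [SimpleGraph.Walk.length_cons] at hp
          omega
        have t1 := hT.1.dist_triangle (u := a) (v := t) (w := j')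
        have t2 := hT.1.dist_triangle (u := a) (v := j') (w := i)
        have h1' : T.dist j' i = 1 := SimpleGraph.dist_eq_one_iff_adj.2 hadj'.symm
        have : j = j' := parent_unique hT (a := a) hadj hadj' h (by omega)
        subst this
        omega
  · omega

lemma exit_descendants (hT : T.IsTree) {a t i j : I} {S : Set I}
    (hi : T.dist a i = T.dist a t + T.dist t i) (hj : T.dist a j ≠ T.dist a t + T.dist t j)
    (h : ReachableIn T S i j) : t ∈ S ∧ ∃ m ∈ S, T.dist a m < T.dist a t := by
  obtain ⟨p, hp⟩ := h
  obtain ⟨d, hd, h1, h2⟩ :=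
    p.exists_boundary_dart {i | T.dist a i = T.dist a t + T.dist t i} hi hj
  obtain ⟨h3, h4⟩ := boundary_of_descendants hT h1 h2 d.adj
  exact ⟨h3 ▸ hp _ (p.dart_fst_mem_support_of_mem_darts hd), _,
    hp _ (p.dart_snd_mem_support_of_mem_darts hd), h4⟩

lemma ReachableIn.left_mem {G : SimpleGraph V} {S : Set V} {x y : V} (h : ReachableIn G S x y) :
    x ∈ S := by
  obtain ⟨p, hp⟩ := h; exact hp _ p.start_mem_support

lemma ReachableIn.right_mem {G : SimpleGraph V} {S : Set V} {x y : V} (h : ReachableIn G S x y) :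
    y ∈ S := by
  obtain ⟨p, hp⟩ := h; exact hp _ p.end_mem_support

lemma ReachableIn.refl {G : SimpleGraph V} {S : Set V} {x : V} (h : x ∈ S) :
    ReachableIn G S x x := ⟨.nil, by simpa using h⟩

lemma ReachableIn.trans {G : SimpleGraph V} {S : Set V} {x y z : V} (h : ReachableIn G S x y)
    (h' : ReachableIn G S y z) : ReachableIn G S x z := by
  obtain ⟨p, hp⟩ := h
  obtain ⟨q, hq⟩ := h'
  refine ⟨p.append q, fun v hv => ?_⟩
  rcases SimpleGraph.Walk.mem_support_append_iff _ _ |>.1 hv with h | h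
  exacts [hp v h, hq v h]

lemma ReachableIn.symm {G : SimpleGraph V} {S : Set V} {x y : V} (h : ReachableIn G S x y) :
    ReachableIn G S y x := by
  obtain ⟨p, hp⟩ := h
  exact ⟨p.reverse, fun v hv => hp v (by simpa using hv)⟩

/-- Under a tree decomposition of width `k`, a component of a vertex set `S` that is closed under
going down the rooted decomposition tree has at most `k` outside neighbours. -/
lemma ncard_outside_neighbours_le [Finite V] {G : SimpleGraph V} {X : I → Set V} {k : ℕ}
    (hX : IsTreeDecomp G T X) (hk : ∀ i, (X i).ncard ≤ k + 1) (a : I) (top : V → I)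
    (htop : ∀ v, v ∈ X (top v)) (hmin : ∀ v i, v ∈ X i → T.dist a (top v) ≤ T.dist a i)
    (S : Set V) (hS : ∀ c ∉ S, ∀ d ∈ S, T.dist a (top c) ≤ T.dist a (top d)) (z : V)
    (hz : z ∈ S) :
    {c | c ∉ S ∧ ∃ d, G.Adj c d ∧ ReachableIn G S z d}.ncard ≤ k := by
  obtain ⟨hT, -, hedge, hconn⟩ := hX
  obtain ⟨v, hv, hvmin⟩ := Set.exists_min_image {d | ReachableIn G S z d}
    (fun d => T.dist a (top d)) (Set.toFinite _) ⟨z, ReachableIn.refl hz⟩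
  set t := top v with ht
  have key : ∀ d, ReachableIn G S z d → (∃ i, d ∈ X i ∧ T.dist a i = T.dist a t + T.dist t i) →
      ∀ j, d ∈ X j → T.dist a j = T.dist a t + T.dist t j := by
    rintro d hd ⟨i, hdi, hi⟩ j hdj
    by_contra hj
    obtain ⟨-, m, hm, hlt⟩ := exit_descendants hT hi hj (hconn d i j hdi hdj)
    have := hmin d m hm
    have := hvmin d hd
    omega
  have key' : ∀ x d, ∀ p : G.Walk x d, ReachableIn G S z x → (∀ u ∈ p.support, u ∈ S) →
      (∀ j, x ∈ X j → T.dist a j = T.dist a t + T.dist t j) →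
      ∀ j, d ∈ X j → T.dist a j = T.dist a t + T.dist t j := by
    intro x d p
    induction p with
    | nil => intro _ _ h; exact h
    | @cons x y d h p ih =>
      intro hx hp hall
      have hy : ReachableIn G S z y := hx.trans
        ⟨.cons h .nil, fun u hu => hp u (by
          simp only [SimpleGraph.Walk.support_cons, SimpleGraph.Walk.support_nil, List.mem_cons,
            List.not_mem_nil, or_false] at hu ⊢
          rcases hu with rfl | rfl <;> simp)⟩
      refine ih hy (fun u hu => hp u (by simp [hu])) (key y hy ?_)
      obtain ⟨i, hxi, hyi⟩ := hedge _ _ h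
      exact ⟨i, hyi, hall i hxi⟩
  have hall : ∀ d, ReachableIn G S z d →
      ∀ j, d ∈ X j → T.dist a j = T.dist a t + T.dist t j := by
    intro d hd
    obtain ⟨p, hp⟩ := (ReachableIn.symm hv).trans hd
    exact key' v d p hv hp (key v hv ⟨t, htop v, by simp⟩)
  have hvN : v ∉ {c | c ∉ S ∧ ∃ d, G.Adj c d ∧ ReachableIn G S z d} :=
    fun h => h.1 hv.right_mem
  have hsub : insert v {c | c ∉ S ∧ ∃ d, G.Adj c d ∧ ReachableIn G S z d} ⊆ X t := by
    rintro c (rfl | ⟨hc, d, hcd, hd⟩)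
    · exact htop _
    obtain ⟨i, hci, hdi⟩ := hedge _ _ hcd
    have hi := hall d hd i hdi
    by_cases h : T.dist a (top c) = T.dist a t + T.dist t (top c)
    · have h0 : T.dist a (top c) ≤ T.dist a t := hS c hc v hv.right_mem
      have : t = top c := hT.1.dist_eq_zero_iff.1 (by omega)
      rw [this]
      exact htop c
    · exact (exit_descendants hT hi h (hconn c i _ hci (htop c))).1
  have h1 := Set.ncard_le_ncard hsub (Set.toFinite _)
  rw [Set.ncard_insert_of_notMem hvN (Set.toFinite _)] at h1
  have := hk t
  omega

/-- A graph of treewidth at most `k` has a vertex ordering such that, for every suffix of the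
ordering, each component of the suffix has at most `k` neighbours among the earlier vertices. -/
lemma exists_elimination_order [Fintype V] {G : SimpleGraph V} {k : ℕ}
    (h : TreewidthAtMost G k) :
    ∃ l : List V, l.Nodup ∧ (∀ v, v ∈ l) ∧ ∀ l', l' <:+ l → ∀ z ∈ l',
      {c | c ∉ l' ∧ ∃ d, G.Adj c d ∧ ReachableIn G {x | x ∈ l'} z d}.ncard ≤ k := by
  classical
  obtain ⟨I, hI, T, X, hX, hk⟩ := h
  obtain ⟨a⟩ := hX.1.1.nonempty
  have hex : ∀ v, ∃ i, v ∈ X i ∧ ∀ j, v ∈ X j → T.dist a i ≤ T.dist a j := fun v =>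
    Set.exists_min_image {i | v ∈ X i} (T.dist a) (Set.toFinite _) (hX.2.1 v)
  choose top htop hmin using hex
  let R : V → V → Prop := fun c d => T.dist a (top c) ≤ T.dist a (top d)
  have : Std.Total R := ⟨fun c d => le_total _ _⟩
  have : IsTrans V R := ⟨fun _ _ _ => le_trans⟩
  refine ⟨(Finset.univ : Finset V).toList.insertionSort R, ?_, by simp, ?_⟩
  · exact (List.perm_insertionSort R _).nodup_iff.2 (Finset.nodup_toList _)
  · rintro l' ⟨l₀, hl⟩ z hz
    have hs : (l₀ ++ l').Pairwise R := hl ▸ List.pairwise_insertionSort R _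
    refine ncard_outside_neighbours_le hX hk a top htop hmin {x | x ∈ l'} ?_ z hz
    intro c hc d hd
    refine (List.pairwise_append.1 hs).2.2 c ?_ d hd
    have : c ∈ l₀ ++ l' := by rw [hl]; simp
    exact (List.mem_append.1 this).resolve_right hc

end EliminationOrder

section TruncatedGeometric

/-- Weight of `g` under the geometric distribution of ratio `q` truncated to `{0, …, N - 1}`. -/
noncomputable def geomWeight (q : ℝ) (N g : ℕ) : ℝ := q ^ g * (1 - q) / (1 - q ^ N)

lemma sum_pow_fin_le {r : ℕ} (H : Finset (Fin r)) (p₀ : ℕ) (h : ∀ p ∈ H, p₀ ≤ (p : ℕ)) :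
    ∑ p ∈ H, (1 / 8 : ℝ) ^ (p : ℕ) ≤ 8 / 7 * (1 / 8) ^ p₀ := by
  have h1 : ∑ p ∈ H, (1 / 8 : ℝ) ^ (p : ℕ) = ∑ j ∈ H.map Fin.valEmbedding, (1 / 8 : ℝ) ^ j := by
    simp
  have h2 : H.map Fin.valEmbedding ⊆ Finset.Ico p₀ (p₀ + r) := by
    intro j hj
    obtain ⟨p, hp, rfl⟩ := Finset.mem_map.1 hj
    have := p.2
    simp only [Fin.valEmbedding_apply, Finset.mem_Ico]
    exact ⟨h p hp, by omega⟩
  have h3 := geom_sum_Ico_mul (1 / 8 : ℝ) (m := p₀) (n := p₀ + r) (by omega)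
  have h4 : ∑ j ∈ H.map Fin.valEmbedding, (1 / 8 : ℝ) ^ j ≤
      ∑ j ∈ Finset.Ico p₀ (p₀ + r), (1 / 8 : ℝ) ^ j :=
    Finset.sum_le_sum_of_subset_of_nonneg h2 fun _ _ _ => by positivity
  have h5 : (0 : ℝ) < (1 / 8) ^ (p₀ + r) := by positivity
  rw [h1]
  linarith

variable {q u : ℝ} {N : ℕ}

lemma sum_Ico_geomWeight {a b : ℕ} (h : a ≤ b) :
    ∑ g ∈ Finset.Ico a b, geomWeight q N g = (q ^ a - q ^ b) / (1 - q ^ N) := by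
  have := geom_sum_Ico_mul q h
  simp only [geomWeight]
  rw [← Finset.sum_div, ← Finset.sum_mul]
  congr 1
  linarith

lemma sum_range_geomWeight (hq : q ^ N ≠ 1) :
    ∑ g ∈ Finset.range N, geomWeight q N g = 1 := by
  rw [Finset.range_eq_Ico, sum_Ico_geomWeight (Nat.zero_le N), pow_zero,
    div_self (sub_ne_zero.2 hq.symm)]

lemma geomWeight_nonneg (h0 : 0 ≤ q) (h1 : q ≤ 1) (g : ℕ) : 0 ≤ geomWeight q N g :=
  div_nonneg (mul_nonneg (pow_nonneg h0 _) (by linarith)) (by linarith [pow_le_one₀ h0 h1 (n := N)])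

/-- The expected gain from being hit at radius `m`. -/
lemma sum_geomWeight_gain (hu : 9 / 10 ≤ u) (hu1 : u < 1) {m : ℕ} (hm : m ≤ N) (hN : N ≠ 0) :
    -(3 * (u ^ 3) ^ N / (1 - (u ^ 3) ^ N)) ≤
      ∑ g ∈ Finset.Ico m N, geomWeight (u ^ 3) N g * (0.7875 * u⁻¹ ^ (g - m) - 1) := by
  have hu0 : 0 < u := by linarith
  obtain ⟨n, rfl⟩ := Nat.exists_eq_add_of_le hm
  have hq1 : (u ^ 3) ^ (m + n) < 1 :=
    pow_lt_one₀ (by positivity) (pow_lt_one₀ hu0.le hu1 (by simp)) hN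
  have hD : 0 < 1 - (u ^ 3) ^ (m + n) := by linarith
  have hsum : ∑ g ∈ Finset.Ico m (m + n),
      geomWeight (u ^ 3) (m + n) g * (0.7875 * u⁻¹ ^ (g - m) - 1) =
      (u ^ 3) ^ m * (0.7875 * (1 - u ^ 3) * (∑ j ∈ Finset.range n, (u ^ 2) ^ j)
        - (1 - u ^ 3) * (∑ j ∈ Finset.range n, (u ^ 3) ^ j)) / (1 - (u ^ 3) ^ (m + n)) := by
    rw [Finset.sum_Ico_eq_sum_range, Nat.add_sub_cancel_left, Finset.mul_sum, Finset.mul_sum,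
      ← Finset.sum_sub_distrib, Finset.mul_sum, Finset.sum_div]
    refine Finset.sum_congr rfl fun j _ => ?_
    rw [Nat.add_sub_cancel_left, geomWeight, pow_add (u ^ 3) m j]
    have : (u ^ 3) ^ j * u⁻¹ ^ j = (u ^ 2) ^ j := by
      rw [← mul_pow]
      congr 1
      field_simp
    linear_combination (0.7875 * (u ^ 3) ^ m * (1 - u ^ 3) / (1 - (u ^ 3) ^ (m + n))) * this
  rw [hsum, ← neg_div, div_le_div_iff_of_pos_right hD]
  have g2 := mul_neg_geom_sum (u ^ 2) n
  have g3 := mul_neg_geom_sum (u ^ 3) n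
  rw [g3]
  set A := ∑ j ∈ Finset.range n, (u ^ 2) ^ j with hA
  have hA0 : 0 ≤ A := Finset.sum_nonneg fun _ _ => by positivity
  have h14 : 1.4 * (1 - u ^ 2) ≤ 1 - u ^ 3 := by
    nlinarith [mul_nonneg (sub_nonneg.2 hu) (sub_nonneg.2 hu1.le),
      mul_nonneg (mul_nonneg (sub_nonneg.2 hu) (sub_nonneg.2 hu1.le)) hu0.le]
  set a := u ^ n with ha
  have ha0 : 0 ≤ a := by positivity
  have ha1 : a ≤ 1 := pow_le_one₀ hu0.le hu1.le
  have e2 : (u ^ 2) ^ n = a ^ 2 := by rw [ha]; ring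
  have e3 : (u ^ 3) ^ n = a ^ 3 := by rw [ha]; ring
  rw [e2] at g2
  rw [pow_add, e3]
  have hq0 : 0 < (u ^ 3) ^ m := by positivity
  have hmain : -(3 * a ^ 3) ≤ 0.7875 * (1 - u ^ 3) * A - (1 - a ^ 3) := by
    have h1 : 1.4 * (1 - a ^ 2) ≤ (1 - u ^ 3) * A := by
      rw [← g2, ← mul_assoc]
      exact mul_le_mul_of_nonneg_right h14 hA0
    have h2 : a ^ 2 ≤ 1 := pow_le_one₀ ha0 ha1
    nlinarith [mul_nonneg ha0 (sq_nonneg (a - 0.18)), sq_nonneg (a - 0.18), sq_nonneg (a-0.2)]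
  nlinarith [mul_le_mul_of_nonneg_left hmain hq0.le]

/-- Averaging the potential over a truncated geometric radius. -/
lemma averaging {r : ℕ} (hr : 1 ≤ r) (hu : 9 / 10 ≤ u) (hu1 : u < 1)
    (hN : u ^ N ≤ (1 / 8) ^ r / 100) {y : Fin r → ℝ} (hy0 : ∀ p, 0 ≤ y p)
    {m : Fin r → ℕ} {T : ℕ} (t : ℕ) (hm : ∀ p, m p ≤ N) (hT : T ≤ N) {Y : ℝ} (hY0 : 0 ≤ Y)
    (hY : ∀ p, m p < N → y p ≤ Y) (hYT : T < N → 1 / 3 ≤ Y) {v vmax : ℝ} {W : ℕ → ℝ}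
    (hW : ∀ g < N, v + ∑ p : Fin r, (if m p ≤ g then
        (1 / 8) ^ (p : ℕ) * y p * (0.7875 * u⁻¹ ^ (g - m p) - 1) else 0)
        + 0.1 * (1 / 8) ^ (r - 1) * Y * u ^ N ≤ W g)
    (hWT : ∀ g, T ≤ g → W g = vmax) :
    ∑ g ∈ Finset.range N, geomWeight (u ^ 3) N g *
        (if g < T then (1 - (u ^ 3) ^ t) * (1 + u ^ N * (vmax - W g))
          else if g < T + t then 1 else 0) ≤
      (1 - (u ^ 3) ^ t) * (1 + u ^ N * (vmax - v)) := by
  have hu0 : 0 < u := by linarith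
  have hθ : (1 / 8 : ℝ) ^ r ≤ 1 / 8 := by
    simpa using pow_le_pow_of_le_one (by norm_num : (0 : ℝ) ≤ 1 / 8) (by norm_num) hr
  have hθ0 : (0 : ℝ) < (1 / 8) ^ r := by positivity
  have hN0 : N ≠ 0 := by
    rintro rfl
    rw [pow_zero] at hN
    linarith
  set a := u ^ N with ha
  have ha0 : 0 < a := by positivity
  have e3 : (u ^ 3) ^ N = a ^ 3 := by rw [ha]; ring
  have hq0 : 0 ≤ u ^ 3 := by positivity
  have hq1 : u ^ 3 ≤ 1 := pow_le_one₀ hu0.le hu1.le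
  have ha1 : a ≤ 1 / 100 := by linarith
  have ha3 : a ^ 3 ≤ 1 / 100 := by
    calc a ^ 3 ≤ a ^ 1 := pow_le_pow_of_le_one ha0.le (by linarith) (by norm_num)
      _ ≤ 1 / 100 := by simpa using ha1
  have ha30 : 0 < a ^ 3 := by positivity
  have hD : 0 < 1 - a ^ 3 := by linarith
  have hsum1 : ∑ g ∈ Finset.range N, geomWeight (u ^ 3) N g = 1 :=
    sum_range_geomWeight (by rw [e3]; linarith)
  have hw0 : ∀ g, 0 ≤ geomWeight (u ^ 3) N g := geomWeight_nonneg hq0 hq1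
  set E := 1 - (u ^ 3) ^ t with hE
  have hE0 : 0 ≤ E := by
    have := pow_le_one₀ hq0 hq1 (n := t)
    linarith
  -- the mass just beyond the threshold
  have hmass : ∑ g ∈ Finset.range N, geomWeight (u ^ 3) N g *
      (if g < T then 0 else if g < T + t then 1 else 0) ≤
      E * (∑ g ∈ Finset.range N, geomWeight (u ^ 3) N g * (if g < T then 0 else 1)
        + if T < N then a ^ 3 / (1 - a ^ 3) else 0) := by
    have h1 : ∑ g ∈ Finset.range N, geomWeight (u ^ 3) N g *
        (if g < T then 0 else if g < T + t then 1 else 0) =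
        ∑ g ∈ Finset.Ico T (min (T + t) N), geomWeight (u ^ 3) N g := by
      have : Finset.Ico T (min (T + t) N) =
          (Finset.range N).filter (fun g => ¬ g < T ∧ g < T + t) := by
        ext g; simp only [Finset.mem_Ico, Finset.mem_filter, Finset.mem_range]; omega
      rw [this, Finset.sum_filter]
      refine Finset.sum_congr rfl fun g _ => ?_
      by_cases h1 : g < T <;> by_cases h2 : g < T + t <;> simp [h1, h2]
    have h2 : ∑ g ∈ Finset.range N, geomWeight (u ^ 3) N g * (if g < T then 0 else 1) =
        ∑ g ∈ Finset.Ico T N, geomWeight (u ^ 3) N g := by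
      have : Finset.Ico T N = (Finset.range N).filter (fun g => ¬ g < T) := by
        ext g; simp only [Finset.mem_Ico, Finset.mem_filter, Finset.mem_range]; omega
      rw [this, Finset.sum_filter]
      refine Finset.sum_congr rfl fun g _ => ?_
      by_cases h1 : g < T <;> simp [h1]
    rw [h1, h2, sum_Ico_geomWeight (by omega), sum_Ico_geomWeight hT, e3]
    by_cases hTN : T < N
    · rw [if_pos hTN, ← add_div, sub_add_cancel, ← mul_div_assoc]
      refine div_le_div_of_nonneg_right ?_ hD.le
      have : (u ^ 3) ^ (T + t) ≤ (u ^ 3) ^ (min (T + t) N) :=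
        pow_le_pow_of_le_one hq0 hq1 (min_le_left _ _)
      rw [pow_add] at this
      rw [hE]
      linarith
    · have : T = N := by omega
      subst this
      simp [e3]
  -- the gain of potential
  have hgain : (if T < N then a ^ 3 / (1 - a ^ 3) else 0) ≤
      a * ∑ g ∈ Finset.range N, geomWeight (u ^ 3) N g * (W g - v) := by
    set S : Fin r → ℝ := fun p => ∑ g ∈ Finset.Ico (m p) N,
      geomWeight (u ^ 3) N g * (0.7875 * u⁻¹ ^ (g - m p) - 1) with hS
    have h1 : ∑ p : Fin r, (1 / 8 : ℝ) ^ (p : ℕ) * y p * S p + 0.1 * (1 / 8) ^ (r - 1) * Y * a ≤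
        ∑ g ∈ Finset.range N, geomWeight (u ^ 3) N g * (W g - v) := by
      calc _ = ∑ g ∈ Finset.range N, geomWeight (u ^ 3) N g * (∑ p : Fin r, (if m p ≤ g then
            (1 / 8) ^ (p : ℕ) * y p * (0.7875 * u⁻¹ ^ (g - m p) - 1) else 0)
            + 0.1 * (1 / 8) ^ (r - 1) * Y * a) := by
            simp only [mul_add, Finset.sum_add_distrib, ← Finset.sum_mul, hsum1, one_mul,
              Finset.mul_sum]
            congr 1
            rw [Finset.sum_comm]
            refine Finset.sum_congr rfl fun p _ => ?_
            have : Finset.Ico (m p) N = (Finset.range N).filter (fun g => m p ≤ g) := by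
              ext g; simp only [Finset.mem_Ico, Finset.mem_filter, Finset.mem_range]; omega
            rw [hS]
            simp only
            rw [this, Finset.sum_filter, Finset.mul_sum]
            refine Finset.sum_congr rfl fun g _ => ?_
            split_ifs <;> ring
        _ ≤ _ := by
            refine Finset.sum_le_sum fun g hg => mul_le_mul_of_nonneg_left ?_ (hw0 g)
            linarith [hW g (Finset.mem_range.1 hg)]
    have h2 : -(8 / 7 * (4 * a ^ 3 * Y)) ≤ ∑ p : Fin r, (1 / 8 : ℝ) ^ (p : ℕ) * y p * S p := by
      have h3 : ∀ p : Fin r, -(4 * a ^ 3 * Y) ≤ y p * S p := by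
        intro p
        rcases (hm p).lt_or_eq with hp | hp
        · have h4 := sum_geomWeight_gain hu hu1 (hm p) hN0
          rw [e3] at h4
          have h5 : 3 * a ^ 3 / (1 - a ^ 3) ≤ 4 * a ^ 3 := by
            rw [div_le_iff₀ hD]; nlinarith
          have h6 : -(4 * a ^ 3) ≤ S p := by simp only [hS]; linarith
          nlinarith [mul_le_mul_of_nonneg_left h6 (hy0 p),
            mul_le_mul_of_nonneg_left (hY p hp) (by positivity : 0 ≤ 4 * a ^ 3)]
        · have : S p = 0 := by simp [hS, hp]
          rw [this, mul_zero]
          have : 0 ≤ 4 * a ^ 3 * Y := by positivity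
          linarith
      calc _ ≤ ∑ p : Fin r, (1 / 8 : ℝ) ^ (p : ℕ) * (-(4 * a ^ 3 * Y)) := by
            rw [← Finset.sum_mul]
            have h4 := sum_pow_fin_le (Finset.univ : Finset (Fin r)) 0 (by simp)
            have h5 : 0 ≤ 4 * a ^ 3 * Y := by positivity
            nlinarith
        _ ≤ _ := Finset.sum_le_sum fun p _ => by
            rw [mul_assoc _ (y p)]
            exact mul_le_mul_of_nonneg_left (h3 p) (by positivity)
    have h3 : (1 / 8 : ℝ) ^ (r - 1) = 8 * (1 / 8) ^ r := by
      obtain ⟨k, rfl⟩ := Nat.exists_eq_add_of_le hr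
      rw [Nat.add_sub_cancel_left, pow_add]
      ring
    rw [h3] at h1
    have h4 : 100 * a ≤ (1 / 8) ^ r := by linarith
    have h5 : a ^ 2 ≤ a / 100 := by nlinarith
    have h6 : 50 * a * (Y * a) ≤ ∑ g ∈ Finset.range N, geomWeight (u ^ 3) N g * (W g - v) := by
      have h7 : 0 ≤ Y * a := by positivity
      have h8 : a ^ 3 * Y ≤ a / 100 * (Y * a) := by
        calc a ^ 3 * Y = a ^ 2 * (Y * a) := by ring
          _ ≤ _ := mul_le_mul_of_nonneg_right h5 h7
      have h9 := mul_le_mul_of_nonneg_right h4 h7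
      have h10 : 0 ≤ a * (Y * a) := by positivity
      linarith
    have h7 := mul_le_mul_of_nonneg_left h6 ha0.le
    split_ifs with hTN
    · have h8 : a ^ 3 / (1 - a ^ 3) ≤ 2 * a ^ 3 := by
        rw [div_le_iff₀ hD]; nlinarith
      have h9 := mul_le_mul_of_nonneg_right (hYT hTN) ha30.le
      nlinarith
    · have : 0 ≤ a * (50 * a * (Y * a)) := by positivity
      linarith
  calc _ = ∑ g ∈ Finset.range N, geomWeight (u ^ 3) N g *
          (if g < T then E * (1 + a * (vmax - W g)) else 0) +
        ∑ g ∈ Finset.range N, geomWeight (u ^ 3) N g *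
          (if g < T then 0 else if g < T + t then 1 else 0) := by
        rw [← Finset.sum_add_distrib]
        refine Finset.sum_congr rfl fun g _ => ?_
        split_ifs <;> ring
    _ ≤ ∑ g ∈ Finset.range N, geomWeight (u ^ 3) N g *
          (if g < T then E * (1 + a * (vmax - W g)) else 0) +
        E * (∑ g ∈ Finset.range N, geomWeight (u ^ 3) N g * (if g < T then 0 else 1)
          + a * ∑ g ∈ Finset.range N, geomWeight (u ^ 3) N g * (W g - v)) := by
        have := mul_le_mul_of_nonneg_left hgain hE0
        linarith
    _ = ∑ g ∈ Finset.range N, geomWeight (u ^ 3) N g * (E * (1 + a * (vmax - v))) := by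
        rw [mul_add, ← mul_assoc E a, Finset.mul_sum, Finset.mul_sum, ← Finset.sum_add_distrib,
          ← Finset.sum_add_distrib]
        refine Finset.sum_congr rfl fun g _ => ?_
        split_ifs with h
        · ring
        · rw [hWT g (not_lt.1 h)]; ring
    _ = _ := by rw [← Finset.sum_mul, hsum1, one_mul]

end TruncatedGeometric

section BallCarving

variable {G : SimpleGraph V} {w : V → V → ℝ} {N : ℕ} {ε : ℝ}

open scoped Classical in
/-- Carve random balls around the vertices of a list, in order, out of the vertex set `U`. The ball
around a vertex that is still present has radius `g * ε` with `g` distributed according to `ν`. -/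
noncomputable def ballCarving (G : SimpleGraph V) (w : V → V → ℝ) (ε : ℝ) (ν : PMF (Fin N)) :
    List V → Set V → PMF (V → ℕ)
  | [], _ => PMF.pure fun _ => 0
  | v :: vs, U =>
    if v ∈ U then
      ν.bind fun g => (ballCarving G w ε ν vs (U \ cluster G w U v (g * ε))).map
        fun f x => if x ∈ cluster G w U v (g * ε) then 0 else f x + 1
    else ballCarving G w ε ν vs U

lemma ballCarving_diameter (hpos : ∀ u v, G.Adj u v → 0 < w u v) (hsymm : ∀ u v, w u v = w v u)
    (hε : 0 ≤ ε) (ν : PMF (Fin N)) (vs : List V) (U : Set V) (hU : ∀ x ∈ U, x ∈ vs)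
    {f : V → ℕ} (hf : f ∈ (ballCarving G w ε ν vs U).support) {x y : V} (hx : x ∈ U) (hy : y ∈ U)
    (hxy : f x = f y) : ReachWithin G w {v | v ∈ U ∧ f v = f x} (2 * (N * ε)) x y := by
  induction vs generalizing U f with
  | nil => exact absurd (hU x hx) (by simp)
  | cons v vs ih =>
    rw [ballCarving] at hf
    split_ifs at hf with hv
    · obtain ⟨g, -, hf⟩ := (PMF.mem_support_bind_iff _ _ _).1 hf
      obtain ⟨f', hf', rfl⟩ := (PMF.mem_support_map_iff _ _ _).1 hf
      have hg : (g : ℕ) * ε ≤ N * ε :=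
        mul_le_mul_of_nonneg_right (by exact_mod_cast g.2.le) hε
      by_cases hxC : x ∈ cluster G w U v (g * ε)
      · have hyC : y ∈ cluster G w U v (g * ε) := by
          by_contra hyC
          simp [hxC, hyC] at hxy
        have h1 := (ReachWithin.in_cluster hpos hxC).symm hsymm
        have h2 := h1.trans (ReachWithin.in_cluster hpos hyC)
        refine h2.mono (fun a ha => ⟨cluster_subset _ _ _ ha, ?_⟩) (by linarith)
        simp [hxC, ha]
      · have hyC : y ∉ cluster G w U v (g * ε) := by
          intro hyC
          simp [hxC, hyC] at hxy
        have hU' : ∀ a ∈ U \ cluster G w U v (g * ε), a ∈ vs := by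
          rintro a ⟨ha, haC⟩
          refine (List.mem_cons.1 (hU a ha)).resolve_left ?_
          rintro rfl
          exact haC (ReachWithin.refl ha (by positivity))
        refine (ih _ hU' hf' ⟨hx, hxC⟩ ⟨hy, hyC⟩ ?_).mono ?_ le_rfl
        · simpa [hxC, hyC] using hxy
        · rintro a ⟨⟨ha, haC⟩, haf⟩
          exact ⟨ha, by simp [haC, hxC, haf]⟩
    · refine ih U (fun a ha => (List.mem_cons.1 (hU a ha)).resolve_left ?_) hf hx hy hxy
      rintro rfl
      exact hv ha

end BallCarving

section Chains

variable {G : SimpleGraph V} {w : V → V → ℝ} {μ ε : ℝ} {z : V}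

/-- The set `C` has a neighbour in `U` at distance `l` from `z` within `U`, for some `l` with
`c ≤ exp (-μ * l)`. -/
def Linked (G : SimpleGraph V) (w : V → V → ℝ) (μ : ℝ) (z : V) (U C : Set V) (c : ℝ) : Prop :=
  ∃ b ∈ C, ∃ u ∈ U, G.Adj b u ∧ ∃ l, ReachWithin G w U l u z ∧ c ≤ exp (-(μ * l))

/-- Invariant of the ball carving process: the sets `C s` are disjoint from each other and from the
remaining vertex set `U`, and those with non-zero value `y s` are connected, meet the already
processed vertices, and are linked to `z`. -/
structure ChainInvariant (G : SimpleGraph V) (w : V → V → ℝ) (μ : ℝ) (z : V) (rest : List V)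
    (U : Set V) {r : ℕ} (C : Fin r → Set V) (y : Fin r → ℝ) : Prop where
  disjoint_left : ∀ s, Disjoint (C s) U
  disjoint : ∀ s t, s ≠ t → Disjoint (C s) (C t)
  nonneg : ∀ s, 0 ≤ y s
  root : ∀ s, y s ≠ 0 → ∃ a ∈ C s, a ∉ rest ∧ ∀ x ∈ C s, ReachableIn G (C s) a x
  linked : ∀ s, y s ≠ 0 → Linked G w μ z U (C s) (y s)

lemma Linked.mono {U U' C : Set V} {c : ℝ} (h : Linked G w μ z U C c) (hU : U ⊆ U') :
    Linked G w μ z U' C c := by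
  obtain ⟨b, hb, u, hu, hadj, l, hl, hc⟩ := h
  exact ⟨b, hb, u, hU hu, hadj, l, hl.mono hU le_rfl, hc⟩

lemma Linked.le_one (hpos : ∀ u v, G.Adj u v → 0 < w u v) (hμ : 0 ≤ μ) {U C : Set V} {c : ℝ}
    (h : Linked G w μ z U C c) : c ≤ 1 := by
  obtain ⟨b, hb, u, hu, hadj, l, hl, hc⟩ := h
  refine hc.trans (exp_le_one_iff.2 ?_)
  have := mul_nonneg hμ (hl.nonneg hpos)
  linarith

/-- If `z` is at distance at most `l` from `v`, then a ball around `v` not containing `z` is linked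
to `z` after its removal. -/
lemma linked_of_reachWithin {U : Set V} {v : V} {l R : ℝ} (hR : 0 ≤ R)
    (h : ReachWithin G w U l v z) (hz : z ∉ cluster G w U v R) {c : ℝ}
    (hc : c ≤ exp (-(μ * (l - R)))) :
    Linked G w μ z (U \ cluster G w U v R) (cluster G w U v R) c := by
  obtain ⟨b, hb, u, hu, hadj, h'⟩ := ReachWithin.residual hR h hz
  exact ⟨b, hb, u, hu, hadj, _, h', hc⟩

/-- If removing the ball of radius `R'` around `v` destroys the link of `C`, then the ball of radius
`R` inherits the link with a gain of `exp (μ * (R - R'))`. -/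
lemma linked_of_hit (hpos : ∀ u v, G.Adj u v → 0 < w u v) {U C : Set V} {v : V}
    {R R' c : ℝ} (hR : 0 ≤ R) (h : Linked G w μ z U C c)
    (hhit : ¬ Linked G w μ z (U \ cluster G w U v R') C c) (hz : z ∉ cluster G w U v R) :
    Linked G w μ z (U \ cluster G w U v R) (cluster G w U v R) (c * exp (μ * (R - R'))) := by
  obtain ⟨b, hb, u, hu, hadj, l, ⟨p, hp, hpl⟩, hc⟩ := h
  obtain ⟨q, hq, hqC⟩ : ∃ q ∈ p.support, q ∈ cluster G w U v R' := by
    by_contra! hno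
    have hp' : ∀ a ∈ p.support, a ∈ U \ cluster G w U v R' := fun a ha => ⟨hp a ha, hno a ha⟩
    exact hhit ⟨b, hb, u, hp' u p.start_mem_support, hadj, l, ⟨p, hp', hpl⟩, hc⟩
  obtain ⟨l₁, l₂, hl, h₁, h₂⟩ := ReachWithin.split (w := w) p hp hq
  have h₃ : ReachWithin G w U (R' + l) v z :=
    (ReachWithin.trans hqC h₂).mono subset_rfl (by linarith [h₁.nonneg hpos])
  refine linked_of_reachWithin hR h₃ hz ?_
  calc c * exp (μ * (R - R')) ≤ exp (-(μ * l)) * exp (μ * (R - R')) :=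
        mul_le_mul_of_nonneg_right hc (exp_pos _).le
    _ = _ := by rw [← exp_add]; congr 1; ring

lemma exists_outside_neighbour {rest : List V} {C : Set V} {x a d : V} (p : G.Walk x a)
    (hp : ∀ v ∈ p.support, v ∈ C) (ha : a ∉ rest) (hd : G.Adj x d)
    (hzd : ReachableIn G {x | x ∈ rest} z d) :
    ∃ c ∈ C, c ∉ rest ∧ ∃ d, G.Adj c d ∧ ReachableIn G {x | x ∈ rest} z d := by
  induction p generalizing d with
  | nil => exact ⟨_, hp _ (by simp), ha, d, hd, hzd⟩
  | @cons x y a h p ih =>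
    by_cases hx : x ∈ rest
    · refine ih (fun v hv => hp v (by simp [hv])) ha h.symm (hzd.trans ⟨.cons hd.symm .nil, ?_⟩)
      intro v hv
      simp only [SimpleGraph.Walk.support_cons, SimpleGraph.Walk.support_nil, List.mem_cons,
        List.not_mem_nil, or_false] at hv
      rcases hv with rfl | rfl
      exacts [hzd.right_mem, hx]
    · exact ⟨x, hp x (by simp), hx, d, hd, hzd⟩

namespace ChainInvariant

variable {rest : List V} {U : Set V} {r : ℕ} {C : Fin r → Set V} {y : Fin r → ℝ}

lemma le_one (hI : ChainInvariant G w μ z rest U C y) (hpos : ∀ u v, G.Adj u v → 0 < w u v)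
    (hμ : 0 ≤ μ) (s : Fin r) : y s ≤ 1 := by
  by_cases h : y s = 0
  · simp [h]
  · exact (hI.linked s h).le_one hpos hμ

/-- A width bound on the component of `z` leaves some slot with value zero. -/
lemma exists_eq_zero [Finite V] (hI : ChainInvariant G w μ z rest U C y) (hU : ∀ x ∈ U, x ∈ rest)
    (hwidth : {c | c ∉ rest ∧ ∃ d, G.Adj c d ∧
      ReachableIn G {x | x ∈ rest} z d}.ncard < r) : ∃ s, y s = 0 := by
  by_contra! h
  have key : ∀ s, ∃ c ∈ C s, c ∉ rest ∧ ∃ d, G.Adj c d ∧ ReachableIn G {x | x ∈ rest} z d := by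
    intro s
    obtain ⟨a, -, ha, hconn⟩ := hI.root s (h s)
    obtain ⟨b, hb, u, hu, hadj, l, ⟨p, hp, -⟩, -⟩ := hI.linked s (h s)
    obtain ⟨p', hp'⟩ := (hconn b hb).symm
    exact exists_outside_neighbour p' hp' ha hadj
      (ReachableIn.symm ⟨p, fun v hv => hU v (hp v hv)⟩)
  choose c hcC hcN using key
  have hinj : Function.Injective c := by
    intro s t hst
    by_contra hne
    exact Set.disjoint_left.1 (hI.disjoint s t hne) (hcC s) (hst ▸ hcC t)
  have h1 : (Set.range c).ncard ≤ _ := Set.ncard_le_ncard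
    (by rintro _ ⟨s, rfl⟩; exact hcN s : Set.range c ⊆ {c | c ∉ rest ∧ ∃ d, G.Adj c d ∧
      ReachableIn G {x | x ∈ rest} z d}) (Set.toFinite _)
  have h2 : (Set.range c).ncard = r := by
    rw [← Set.image_univ, Set.ncard_image_of_injective _ hinj, Set.ncard_univ, Nat.card_fin]
  omega

open scoped Classical in
/-- Update of the invariant when a ball is carved out. -/
lemma step {v : V} {vs : List V} (hI : ChainInvariant G w μ z (v :: vs) U C y)
    (hpos : ∀ u v, G.Adj u v → 0 < w u v) (hnd : v ∉ vs) (hv : v ∈ U)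
    {R : ℝ} (hR : 0 ≤ R) {p₀ : Fin r} {c : ℝ} (hc0 : 0 ≤ c)
    (hc : c ≠ 0 → Linked G w μ z (U \ cluster G w U v R) (cluster G w U v R) c) :
    ChainInvariant G w μ z vs (U \ cluster G w U v R)
      (Function.update C p₀ (cluster G w U v R))
      (fun s => if s = p₀ then c else
        if y s ≠ 0 ∧ ¬ Linked G w μ z (U \ cluster G w U v R) (C s) (y s) then 0 else y s) := by
  have hCs : ∀ s, Disjoint (C s) (cluster G w U v R) := fun s =>
    (hI.disjoint_left s).mono_right (cluster_subset _ _ _)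
  constructor
  · intro s
    by_cases h : s = p₀
    · subst h
      simpa using Set.disjoint_sdiff_right
    · rw [Function.update_of_ne h]
      exact (hI.disjoint_left s).mono_right Set.sdiff_subset
  · intro s t hst
    by_cases h : s = p₀ <;> by_cases h' : t = p₀
    · exact absurd (h.trans h'.symm) hst
    · subst h
      rw [Function.update_self, Function.update_of_ne h']
      exact (hCs t).symm
    · subst h'
      rw [Function.update_self, Function.update_of_ne h]
      exact hCs s
    · rw [Function.update_of_ne h, Function.update_of_ne h']
      exact hI.disjoint s t hst
  · intro s
    split_ifs
    exacts [hc0, le_rfl, hI.nonneg s]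
  · intro s hs
    by_cases h : s = p₀
    · subst h
      rw [Function.update_self]
      refine ⟨v, ReachWithin.refl hv hR, hnd, fun x hx => ?_⟩
      obtain ⟨p, hp, -⟩ := ReachWithin.in_cluster hpos hx
      exact ⟨p, hp⟩
    · rw [Function.update_of_ne h]
      rw [if_neg h] at hs
      split_ifs at hs with h'
      · exact absurd rfl hs
      · obtain ⟨a, ha, har, hx⟩ := hI.root s hs
        exact ⟨a, ha, fun h => har (by simp [h]), hx⟩
  · intro s hs
    by_cases h : s = p₀
    · subst h
      rw [Function.update_self]
      simp only [if_true] at hs ⊢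
      exact hc hs
    · rw [Function.update_of_ne h]
      simp only [if_neg h] at hs ⊢
      split_ifs at hs ⊢ with h'
      · exact absurd rfl hs
      · by_contra hl
        exact h' ⟨hs, hl⟩

end ChainInvariant

end Chains

section Potential

variable {G : SimpleGraph V} {w : V → V → ℝ} {μ ε ρ u : ℝ} {z v : V} {U B : Set V} {r N : ℕ}
  {C : Fin r → Set V} {y : Fin r → ℝ} {rest vs : List V}

lemma Linked.mono_value {c c' : ℝ} {C : Set V} (h : Linked G w μ z U C c) (hc : c' ≤ c) :
    Linked G w μ z U C c' := by
  obtain ⟨b, hb, u, hu, hadj, l, hl, hcl⟩ := h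
  exact ⟨b, hb, u, hu, hadj, l, hl, hc.trans hcl⟩

lemma ChainInvariant.tail (hI : ChainInvariant G w μ z (v :: vs) U C y) :
    ChainInvariant G w μ z vs U C y where
  disjoint_left := hI.disjoint_left
  disjoint := hI.disjoint
  nonneg := hI.nonneg
  root s hs := by
    obtain ⟨a, ha, har, hx⟩ := hI.root s hs
    exact ⟨a, ha, fun h => har (by simp [h]), hx⟩
  linked := hI.linked

lemma exists_threshold (P : ℕ → Prop) (hP : ∀ g g', g ≤ g' → P g → P g') (N : ℕ) :
    ∃ m ≤ N, ∀ g < N, P g ↔ m ≤ g := by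
  classical
  by_cases h : ∃ g, g < N ∧ P g
  · refine ⟨Nat.find h, (Nat.find_spec h).1.le, fun g hg => ⟨fun hPg => Nat.find_min' h ⟨hg, hPg⟩,
      fun hle => hP _ _ hle (Nat.find_spec h).2⟩⟩
  · push Not at h
    exact ⟨N, le_rfl, fun g hg => ⟨fun hPg => absurd hPg (h g hg), fun hle => by omega⟩⟩

/-- A base value for the chain started at `v`, valid for every radius that misses `B`. -/
lemma exists_base_value (hI : ChainInvariant G w μ z rest U C y)
    (hpos : ∀ u v, G.Adj u v → 0 < w u v) (hsymm : ∀ u v, w u v = w v u) (hμ : 0 ≤ μ) (hε : 0 ≤ ε)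
    (hρ : 0 ≤ ρ) (hμρ : μ * ρ ≤ 1) (hzB : z ∈ B) (hB : ∀ x ∈ B, ReachWithin G w U ρ z x)
    {T : ℕ} (hTN : T ≤ N) (hT : ∀ g < N, (∃ x ∈ B, x ∈ cluster G w U v (g * ε)) ↔ T ≤ g)
    {m : Fin r → ℕ} (hm : ∀ p, ∀ g < N, (y p ≠ 0 ∧
      ¬ Linked G w μ z (U \ cluster G w U v (g * ε)) (C p) (y p)) ↔ m p ≤ g) :
    ∃ Y, 0 ≤ Y ∧ Y ≤ 1 ∧ (∀ p, m p < N → y p ≤ Y) ∧ (T < N → 1 / 3 ≤ Y) ∧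
      ∀ g < T, Y * exp (-(μ * ε)) ^ N ≠ 0 → Linked G w μ z (U \ cluster G w U v (g * ε))
        (cluster G w U v (g * ε)) (Y * exp (-(μ * ε)) ^ N) := by
  classical
  set c₀ : ℝ := if T < N then exp (-(μ * ρ)) else 0 with hc₀
  have hμρ0 : 0 ≤ μ * ρ := mul_nonneg hμ hρ
  have hμε0 : 0 ≤ μ * ε := mul_nonneg hμ hε
  have hpow : exp (-(μ * ε)) ^ N = exp (-(μ * (N * ε))) := by
    rw [← exp_nat_mul]; congr 1; ring
  have hz : ∀ g < T, z ∉ cluster G w U v (g * ε) := fun g hg hzC => by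
    have := (hT g (by omega)).1 ⟨z, hzB, hzC⟩
    omega
  obtain ⟨Y, hYmem, hYmax⟩ := Finset.exists_max_image
    (insert c₀ ((Finset.univ.filter fun p => m p < N).image y)) id (Finset.insert_nonempty _ _)
  have hYc : c₀ ≤ Y := hYmax c₀ (Finset.mem_insert_self _ _)
  have hc0 : 0 ≤ c₀ := by rw [hc₀]; split_ifs <;> positivity
  have hYp : ∀ p, m p < N → y p ≤ Y := fun p hp => hYmax _ (Finset.mem_insert_of_mem
    (Finset.mem_image_of_mem y (by simpa using hp)))
  refine ⟨Y, hc0.trans hYc, ?_, hYp, fun h => ?_, fun g hg hne => ?_⟩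
  · rcases Finset.mem_insert.1 hYmem with rfl | h
    · rw [hc₀]; split_ifs
      · exact exp_le_one_iff.2 (by linarith)
      · norm_num
    · obtain ⟨p, -, rfl⟩ := Finset.mem_image.1 h
      exact hI.le_one hpos hμ p
  · refine le_trans ?_ hYc
    rw [hc₀, if_pos h]
    have := exp_neg_one_gt_d9
    have h1 : exp (-1) ≤ exp (-(μ * ρ)) := exp_le_exp.2 (by linarith)
    linarith
  · have hgε : 0 ≤ (g : ℝ) * ε := by positivity
    rcases Finset.mem_insert.1 hYmem with rfl | h
    · rw [hc₀] at hne ⊢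
      split_ifs at hne ⊢ with h
      · obtain ⟨x, hxB, hx⟩ := (hT T h).2 le_rfl
        refine linked_of_reachWithin hgε (ReachWithin.trans hx ((hB x hxB).symm hsymm)) (hz g hg) ?_
        rw [hpow, ← exp_add, exp_le_exp]
        have h1 : (T : ℝ) ≤ N := by exact_mod_cast hTN
        have h2 : 0 ≤ (N - T + g : ℝ) := by
          have : (0 : ℝ) ≤ g := by positivity
          linarith
        nlinarith [mul_nonneg hμε0 h2]
      · simp at hne
    · obtain ⟨p, hp, rfl⟩ := Finset.mem_image.1 h
      have hp : m p < N := by simpa using hp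
      obtain ⟨hy, hhit⟩ := (hm p (m p) hp).2 le_rfl
      refine (linked_of_hit hpos hgε (hI.linked p hy) hhit (hz g hg)).mono_value ?_
      refine mul_le_mul_of_nonneg_left ?_ (hI.nonneg p)
      rw [hpow, exp_le_exp]
      have h1 : (m p : ℝ) ≤ N := by exact_mod_cast hp.le
      have h2 : 0 ≤ (N - m p + g : ℝ) := by
        have : (0 : ℝ) ≤ g := by positivity
        linarith
      nlinarith [mul_nonneg hμε0 h2]

/-- Carving out a ball that misses `B` increases the potential. -/
lemma exists_step (hI : ChainInvariant G w μ z (v :: vs) U C y)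
    (hpos : ∀ u v, G.Adj u v → 0 < w u v) (hε : 0 ≤ ε)
    (hnd : v ∉ vs) (hv : v ∈ U) (hfree : ∃ s, y s = 0) {g : ℕ} (hg : g < N)
    (hz : z ∉ cluster G w U v (g * ε))
    {m : Fin r → ℕ} (hm : ∀ p, ∀ g < N, (y p ≠ 0 ∧
      ¬ Linked G w μ z (U \ cluster G w U v (g * ε)) (C p) (y p)) ↔ m p ≤ g)
    {Y : ℝ} (hY : 0 ≤ Y) (hYL : Y * exp (-(μ * ε)) ^ N ≠ 0 →
      Linked G w μ z (U \ cluster G w U v (g * ε))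
        (cluster G w U v (g * ε)) (Y * exp (-(μ * ε)) ^ N)) :
    ∃ (C' : Fin r → Set V) (y' : Fin r → ℝ),
      ChainInvariant G w μ z vs (U \ cluster G w U v (g * ε)) C' y' ∧
      ∑ p : Fin r, (1 / 8 : ℝ) ^ (p : ℕ) * y p + ∑ p : Fin r, (if m p ≤ g then
        (1 / 8) ^ (p : ℕ) * y p * (0.7875 * (exp (-(μ * ε)))⁻¹ ^ (g - m p) - 1) else 0)
        + 0.1 * (1 / 8) ^ (r - 1) * Y * exp (-(μ * ε)) ^ N ≤
      ∑ p : Fin r, (1 / 8 : ℝ) ^ (p : ℕ) * y' p := by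
  classical
  set H : Finset (Fin r) := Finset.univ.filter fun p => m p ≤ g with hH
  set s : ℝ := (exp (-(μ * ε)))⁻¹ with hs
  have hs0 : 0 < s := by positivity
  set c₀ := Y * exp (-(μ * ε)) ^ N with hc₀
  have hc₀0 : 0 ≤ c₀ := by positivity
  obtain ⟨c, hcmem, hcmax⟩ := Finset.exists_max_image
    (insert c₀ (H.image fun p => y p * s ^ (g - m p))) id (Finset.insert_nonempty _ _)
  have hc0 : c₀ ≤ c := hcmax c₀ (Finset.mem_insert_self _ _)
  have hcH : ∀ p ∈ H, y p * s ^ (g - m p) ≤ c := fun p hp => hcmax _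
    (Finset.mem_insert_of_mem (Finset.mem_image_of_mem (fun p => y p * s ^ (g - m p)) hp))
  have hcL : c ≠ 0 → Linked G w μ z (U \ cluster G w U v (g * ε)) (cluster G w U v (g * ε)) c := by
    intro hne
    rcases Finset.mem_insert.1 hcmem with rfl | h
    · exact hYL hne
    · obtain ⟨p, hp, rfl⟩ := Finset.mem_image.1 h
      have hpg : m p ≤ g := (Finset.mem_filter.1 hp).2
      obtain ⟨hy, hhit⟩ := (hm p (m p) (by omega)).2 le_rfl
      refine (linked_of_hit hpos (by positivity) (hI.linked p hy) hhit hz).mono_value ?_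
      refine mul_le_mul_of_nonneg_left (le_of_eq ?_) (hI.nonneg p)
      rw [hs, ← exp_neg, ← exp_nat_mul, Nat.cast_sub hpg]
      congr 1
      ring
  obtain ⟨p₀, hp₀, hp₀H⟩ : ∃ p₀ : Fin r, (p₀ ∈ H ∨ y p₀ = 0) ∧ ∀ p ∈ H, p₀ ≤ p := by
    by_cases hne : H.Nonempty
    · exact ⟨H.min' hne, Or.inl (H.min'_mem hne), fun p hp => H.min'_le p hp⟩
    · obtain ⟨f, hf⟩ := hfree
      rw [Finset.not_nonempty_iff_eq_empty] at hne
      exact ⟨f, Or.inr hf, by simp [hne]⟩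
  refine ⟨_, _, hI.step hpos hnd hv (by positivity : 0 ≤ (g : ℝ) * ε) (p₀ := p₀)
    (hc₀0.trans hc0) hcL, ?_⟩
  have e1 : ∑ p : Fin r, (1 / 8 : ℝ) ^ (p : ℕ) * (if p = p₀ then c else
      if y p ≠ 0 ∧ ¬ Linked G w μ z (U \ cluster G w U v (g * ε)) (C p) (y p) then 0 else y p) =
      (1 / 8 : ℝ) ^ (p₀ : ℕ) * c + (∑ p : Fin r, (1 / 8 : ℝ) ^ (p : ℕ) * y p
        - ∑ p ∈ H, (1 / 8 : ℝ) ^ (p : ℕ) * y p) := by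
    have : (1 / 8 : ℝ) ^ (p₀ : ℕ) * c =
        ∑ p : Fin r, if p = p₀ then (1 / 8 : ℝ) ^ (p : ℕ) * c else 0 := by simp
    rw [this, hH, Finset.sum_filter, ← Finset.sum_sub_distrib, ← Finset.sum_add_distrib]
    refine Finset.sum_congr rfl fun p _ => ?_
    simp only [hm p g hg]
    by_cases hp : p = p₀
    · subst hp
      rw [if_pos rfl, if_pos rfl]
      rcases hp₀ with h | h
      · rw [if_pos (Finset.mem_filter.1 h).2]; ring
      · rw [h]; split_ifs <;> ring
    · rw [if_neg hp, if_neg hp]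
      split_ifs <;> ring
  have e2 : ∑ p : Fin r, (if m p ≤ g then
        (1 / 8) ^ (p : ℕ) * y p * (0.7875 * s ^ (g - m p) - 1) else 0) =
      0.7875 * ∑ p ∈ H, (1 / 8 : ℝ) ^ (p : ℕ) * (y p * s ^ (g - m p))
        - ∑ p ∈ H, (1 / 8 : ℝ) ^ (p : ℕ) * y p := by
    rw [← Finset.sum_filter, Finset.mul_sum, ← Finset.sum_sub_distrib]
    exact Finset.sum_congr rfl fun p _ => by ring
  rw [e1, e2]
  have e3 : ∑ p ∈ H, (1 / 8 : ℝ) ^ (p : ℕ) * (y p * s ^ (g - m p)) ≤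
      8 / 7 * (1 / 8) ^ (p₀ : ℕ) * c := by
    calc _ ≤ ∑ p ∈ H, (1 / 8 : ℝ) ^ (p : ℕ) * c :=
          Finset.sum_le_sum fun p hp => mul_le_mul_of_nonneg_left (hcH p hp) (by positivity)
      _ ≤ _ := by
          rw [← Finset.sum_mul]
          exact mul_le_mul_of_nonneg_right (sum_pow_fin_le H p₀ hp₀H) (hc₀0.trans hc0)
  have e4 : (1 / 8 : ℝ) ^ (r - 1) * c₀ ≤ (1 / 8) ^ (p₀ : ℕ) * c := by
    have h1 : (1 / 8 : ℝ) ^ (r - 1) ≤ (1 / 8) ^ (p₀ : ℕ) :=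
      pow_le_pow_of_le_one (by norm_num) (by norm_num) (by have := p₀.2; omega)
    exact mul_le_mul h1 hc0 hc₀0 (by positivity)
  have e5 : 0.1 * (1 / 8 : ℝ) ^ (r - 1) * Y * exp (-(μ * ε)) ^ N =
      0.1 * ((1 / 8 : ℝ) ^ (r - 1) * c₀) := by rw [hc₀]; ring
  rw [e5]
  linarith

/-- The potential never exceeds `3 * u⁻¹ ^ N`, even after a fictitious gain. -/
lemma potential_le (hu0 : 0 < u) (hu1 : u ≤ 1) (hy1 : ∀ p, y p ≤ 1)
    {m : Fin r → ℕ} {g : ℕ} (hg : g < N) {Y : ℝ} (hY : 0 ≤ Y) (hY1 : Y ≤ 1) :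
    ∑ p : Fin r, (1 / 8 : ℝ) ^ (p : ℕ) * y p + ∑ p : Fin r, (if m p ≤ g then
        (1 / 8) ^ (p : ℕ) * y p * (0.7875 * u⁻¹ ^ (g - m p) - 1) else 0)
        + 0.1 * (1 / 8) ^ (r - 1) * Y * u ^ N ≤ 3 * u⁻¹ ^ N := by
  have hs1 : 1 ≤ u⁻¹ := (one_le_inv₀ hu0).2 hu1
  have hsN : 1 ≤ u⁻¹ ^ N := one_le_pow₀ hs1
  have h1 : ∑ p : Fin r, (1 / 8 : ℝ) ^ (p : ℕ) * y p + ∑ p : Fin r, (if m p ≤ g then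
        (1 / 8) ^ (p : ℕ) * y p * (0.7875 * u⁻¹ ^ (g - m p) - 1) else 0) ≤
      ∑ p : Fin r, (1 / 8 : ℝ) ^ (p : ℕ) * u⁻¹ ^ N := by
    rw [← Finset.sum_add_distrib]
    refine Finset.sum_le_sum fun p _ => ?_
    have hθ : (0 : ℝ) < (1 / 8) ^ (p : ℕ) := by positivity
    have hyN : y p ≤ u⁻¹ ^ N := (hy1 p).trans hsN
    split_ifs with h
    · have h2 : u⁻¹ ^ (g - m p) ≤ u⁻¹ ^ N := pow_le_pow_right₀ hs1 (by omega)
      have h3 : 0 < u⁻¹ ^ (g - m p) := by positivity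
      have h4 : y p * (0.7875 * u⁻¹ ^ (g - m p)) ≤ 1 * u⁻¹ ^ N :=
        mul_le_mul (hy1 p) (by linarith) (by positivity) (by norm_num)
      nlinarith [mul_le_mul_of_nonneg_left h4 hθ.le]
    · nlinarith [mul_le_mul_of_nonneg_left hyN hθ.le]
  rw [← Finset.sum_mul] at h1
  have h2 := sum_pow_fin_le (Finset.univ : Finset (Fin r)) 0 (by simp)
  have h3 := mul_le_mul_of_nonneg_right h2 (by positivity : 0 ≤ u⁻¹ ^ N)
  have h4 : (1 / 8 : ℝ) ^ (r - 1) * Y * u ^ N ≤ 1 :=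
    mul_le_one₀ (mul_le_one₀ (pow_le_one₀ (by norm_num) (by norm_num)) hY hY1) (by positivity)
      (pow_le_one₀ hu0.le hu1)
  linarith

end Potential

section CutProbability

variable {G : SimpleGraph V} {w : V → V → ℝ} {μ ε ρ : ℝ} {z : V} {r N t : ℕ}

lemma sum_ofReal_mul_le {ν : Fin N → ℝ≥0∞} {b : ℕ → ℝ} {c : ℕ → ℝ} {X : Fin N → ℝ≥0∞}
    (hν : ∀ g, ν g = ENNReal.ofReal (c g)) (hc : ∀ g, 0 ≤ c g) (hb : ∀ g, 0 ≤ b g)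
    (hX : ∀ g, X g ≤ ENNReal.ofReal (b g)) {D : ℝ} (hD : ∑ g ∈ Finset.range N, c g * b g ≤ D) :
    ∑' g, ν g * X g ≤ ENNReal.ofReal D := by
  rw [tsum_fintype]
  calc ∑ g, ν g * X g ≤ ∑ g : Fin N, ENNReal.ofReal (c g * b g) :=
        Finset.sum_le_sum fun g _ => by
          rw [ENNReal.ofReal_mul (hc g), hν]
          exact mul_le_mul_right (hX g) _
    _ = ENNReal.ofReal (∑ g ∈ Finset.range N, c g * b g) := by
        rw [Finset.sum_range,
          ENNReal.ofReal_sum_of_nonneg fun (g : Fin N) _ => mul_nonneg (hc g) (hb g)]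
    _ ≤ _ := ENNReal.ofReal_le_ofReal hD

lemma toOuterMeasure_le_one {α : Type*} (P : PMF α) (s : Set α) : P.toOuterMeasure s ≤ 1 := by
  rw [PMF.toOuterMeasure_apply, ← P.tsum_coe]
  exact ENNReal.tsum_le_tsum fun a => Set.indicator_le_self _ _ _

/-- The probability that a small ball `B` around `z` is cut by the remaining part of the ball
carving process, in terms of the current chain invariant. -/
lemma ballCarving_cut_le [Finite V] (hpos : ∀ u v, G.Adj u v → 0 < w u v)
    (hsymm : ∀ u v, w u v = w v u) (hμ : 0 ≤ μ) (hε : 0 ≤ ε) (hρ : 0 ≤ ρ) (hμρ : μ * ρ ≤ 1)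
    (ht : 2 * ρ ≤ t * ε) (hr : 1 ≤ r) {u : ℝ} (hue : u = exp (-(μ * ε))) (hu : 9 / 10 ≤ u)
    (hu1 : u < 1) (hN : u ^ N ≤ (1 / 8) ^ r / 100) {ν : PMF (Fin N)}
    (hν : ∀ g, ν g = ENNReal.ofReal (geomWeight (u ^ 3) N g)) {B : Set V}
    (hB : ∀ U, B ⊆ U → ∀ x ∈ B, ReachWithin G w U ρ z x) (hzB : z ∈ B) (rest : List V)
    (hwidth : ∀ l', l' <:+ rest → z ∈ l' → {c | c ∉ l' ∧ ∃ d, G.Adj c d ∧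
      ReachableIn G {x | x ∈ l'} z d}.ncard < r) (hnd : rest.Nodup) (U : Set V)
    (hU : ∀ x ∈ U, x ∈ rest) (hBU : B ⊆ U) (C : Fin r → Set V) (y : Fin r → ℝ)
    (hI : ChainInvariant G w μ z rest U C y) :
    (ballCarving G w ε ν rest U).toOuterMeasure {f | ∃ x ∈ B, f x ≠ f z} ≤
      ENNReal.ofReal ((1 - (u ^ 3) ^ t) *
        (1 + u ^ N * (3 * u⁻¹ ^ N - ∑ p : Fin r, (1 / 8 : ℝ) ^ (p : ℕ) * y p))) := by
  classical
  induction rest generalizing U C y with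
  | nil => exact absurd (hU z (hBU hzB)) (by simp)
  | cons v vs ih =>
    have hu0 : 0 < u := by linarith
    have hwidth' : ∀ l', l' <:+ vs → z ∈ l' → {c | c ∉ l' ∧ ∃ d, G.Adj c d ∧
        ReachableIn G {x | x ∈ l'} z d}.ncard < r := fun l' hl' =>
      hwidth l' (hl'.trans (List.suffix_cons v vs))
    have hnd' := List.nodup_cons.1 hnd
    rw [ballCarving]
    split_ifs with hv
    swap
    · refine ih hwidth' hnd'.2 U (fun x hx => (List.mem_cons.1 (hU x hx)).resolve_left ?_) hBU C y
        hI.tail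
      rintro rfl
      exact hv hx
    have hUB := hB U hBU
    have hmono : ∀ g g' : ℕ, g ≤ g' → cluster G w U v (g * ε) ⊆ cluster G w U v (g' * ε) :=
      fun g g' h => cluster_mono U v (mul_le_mul_of_nonneg_right (by exact_mod_cast h) hε)
    obtain ⟨T, hTN, hT⟩ := exists_threshold (fun g => ∃ x ∈ B, x ∈ cluster G w U v (g * ε))
      (fun g g' h ⟨x, hx, hxC⟩ => ⟨x, hx, hmono g g' h hxC⟩) N
    have hmex : ∀ p, ∃ m ≤ N, ∀ g < N, (y p ≠ 0 ∧
        ¬ Linked G w μ z (U \ cluster G w U v (g * ε)) (C p) (y p)) ↔ m ≤ g := fun p =>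
      exists_threshold (fun g => y p ≠ 0 ∧
        ¬ Linked G w μ z (U \ cluster G w U v (g * ε)) (C p) (y p))
        (fun g g' h ⟨h1, h2⟩ => ⟨h1, fun h3 => h2 (h3.mono
          (Set.sdiff_subset_sdiff_right (hmono g g' h)))⟩) N
    choose m hmN hm using hmex
    obtain ⟨Y, hY0, hY1, hYp, hYT, hYL⟩ :=
      exists_base_value hI hpos hsymm hμ hε hρ hμρ hzB hUB hTN hT hm
    rw [← hue] at hYL
    have hfree := hI.exists_eq_zero hU (hwidth _ List.suffix_rfl (hU z (hBU hzB)))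
    set v₀ := ∑ p : Fin r, (1 / 8 : ℝ) ^ (p : ℕ) * y p with hv₀
    have hdisj : ∀ g < T, ∀ x ∈ B, x ∉ cluster G w U v (g * ε) := fun g hg x hx hxC => by
      have := (hT g (by omega)).1 ⟨x, hx, hxC⟩
      omega
    have hWex : ∀ g : ℕ, ∃ W : ℝ, (T ≤ g → W = 3 * u⁻¹ ^ N) ∧
        (g < T → ∃ (C' : Fin r → Set V) (y' : Fin r → ℝ),
          ChainInvariant G w μ z vs (U \ cluster G w U v (g * ε)) C' y' ∧
          W = ∑ p : Fin r, (1 / 8 : ℝ) ^ (p : ℕ) * y' p) ∧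
        (g < N → v₀ + ∑ p : Fin r, (if m p ≤ g then
          (1 / 8) ^ (p : ℕ) * y p * (0.7875 * u⁻¹ ^ (g - m p) - 1) else 0)
          + 0.1 * (1 / 8) ^ (r - 1) * Y * u ^ N ≤ W) := by
      intro g
      by_cases hg : g < T
      · obtain ⟨C', y', hI', hle⟩ := exists_step hI hpos hε hnd'.1 hv hfree (hg.trans_le hTN)
          (hdisj g hg z hzB) hm hY0 (hue ▸ hYL g hg)
        rw [← hue] at hle
        exact ⟨_, fun h => by omega, fun _ => ⟨C', y', hI', rfl⟩, fun _ => hle⟩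
      · exact ⟨_, fun _ => rfl, fun h => absurd h hg,
          fun h => potential_le hu0 hu1.le (fun p => hI.le_one hpos hμ p) h hY0 hY1⟩
    choose W hWT hWI hW using hWex
    have hq0 : 0 ≤ u ^ 3 := by positivity
    have hq1 : u ^ 3 ≤ 1 := pow_le_one₀ hu0.le hu1.le
    have hE : 0 ≤ 1 - (u ^ 3) ^ t := by
      have := pow_le_one₀ hq0 hq1 (n := t)
      linarith
    have hW3 : ∀ g < T, W g ≤ 3 * u⁻¹ ^ N := by
      intro g hg
      obtain ⟨C', y', hI', hWe⟩ := hWI g hg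
      have hs1 : 1 ≤ u⁻¹ ^ N := one_le_pow₀ ((one_le_inv₀ hu0).2 hu1.le)
      have h1 := sum_pow_fin_le (Finset.univ : Finset (Fin r)) 0 (by simp)
      have h2 : ∑ p : Fin r, (1 / 8 : ℝ) ^ (p : ℕ) * y' p ≤ ∑ p : Fin r, (1 / 8 : ℝ) ^ (p : ℕ) :=
        Finset.sum_le_sum fun p _ =>
          mul_le_of_le_one_right (by positivity) (hI'.le_one hpos hμ p)
      rw [hWe]
      linarith
    rw [PMF.toOuterMeasure_bind_apply]
    refine sum_ofReal_mul_le hν (geomWeight_nonneg hq0 hq1) (fun g => ?_) (fun g => ?_)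
      (averaging hr hu hu1 hN hI.nonneg t hmN hTN hY0 hYp hYT (fun g hg => hW g hg) hWT)
    · split_ifs with h
      · have := mul_nonneg (pow_nonneg hu0.le N) (sub_nonneg.2 (hW3 g h))
        exact mul_nonneg hE (by linarith)
      · norm_num
      · norm_num
    · rw [PMF.toOuterMeasure_map_apply]
      by_cases h1 : (g : ℕ) < T
      · rw [if_pos h1]
        obtain ⟨C', y', hI', hWe⟩ := hWI g h1
        have hsub : ((fun (f : V → ℕ) x => if x ∈ cluster G w U v (g * ε) then 0 else f x + 1) ⁻¹'
            {f | ∃ x ∈ B, f x ≠ f z}) ⊆ {f | ∃ x ∈ B, f x ≠ f z} := by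
          rintro f ⟨x, hx, hne⟩
          refine ⟨x, hx, fun h => hne ?_⟩
          simp [h, hdisj g h1 x hx, hdisj g h1 z hzB]
        refine (measure_mono hsub).trans ?_
        rw [hWe]
        refine ih hwidth' hnd'.2 (U \ cluster G w U v (g * ε))
          (fun x hx => (List.mem_cons.1 (hU x hx.1)).resolve_left ?_)
          (fun x hx => ⟨hBU hx, hdisj g h1 x hx⟩) C' y' hI'
        rintro rfl
        exact hx.2 (ReachWithin.refl hx.1 (by positivity))
      · rw [if_neg h1]
        by_cases h2 : (g : ℕ) < T + t
        · rw [if_pos h2, ENNReal.ofReal_one]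
          exact toOuterMeasure_le_one _ _
        · rw [if_neg h2, ENNReal.ofReal_zero]
          have hBC : ∀ x ∈ B, x ∈ cluster G w U v (g * ε) := by
            intro x hx
            obtain ⟨x₀, hx₀, hx₀C⟩ := (hT T (by have := g.2; omega)).2 le_rfl
            refine ((ReachWithin.trans hx₀C ((hUB x₀ hx₀).symm hsymm)).trans
              (hUB x hx)).mono subset_rfl ?_
            have h3 : ((T + t : ℕ) : ℝ) * ε ≤ g * ε :=
              mul_le_mul_of_nonneg_right (by exact_mod_cast not_lt.1 h2) hε
            push_cast at h3
            linarith
          have hempty : ((fun (f : V → ℕ) x =>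
              if x ∈ cluster G w U v (g * ε) then 0 else f x + 1) ⁻¹'
              {f | ∃ x ∈ B, f x ≠ f z}) = ∅ := by
            refine Set.eq_empty_iff_forall_notMem.2 ?_
            rintro f ⟨x, hx, hne⟩
            exact hne (by simp [hBC x hx, hBC z hzB])
          rw [hempty, measure_empty]

lemma exists_weight_lower_bound [Finite V] (hpos : ∀ u v, G.Adj u v → 0 < w u v) :
    ∃ δ > 0, ∀ u v, G.Adj u v → δ ≤ w u v := by
  by_cases h : {p : V × V | G.Adj p.1 p.2}.Nonempty
  · obtain ⟨p, hp, hmin⟩ := Set.exists_min_image _ (fun p : V × V => w p.1 p.2) (Set.toFinite _) h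
    exact ⟨_, hpos _ _ hp, fun u v huv => hmin (u, v) huv⟩
  · exact ⟨1, one_pos, fun u v huv => absurd ⟨(u, v), huv⟩ h⟩

lemma gball_subset_singleton {δ : ℝ} (hδ : 0 < δ) (hw : ∀ u v, G.Adj u v → δ ≤ w u v) (z : V)
    (hρ : ρ < δ) : gball G w z ρ ⊆ {z} := by
  intro x hx
  have h1 : dIn G w Set.univ z x < ENNReal.ofReal δ :=
    lt_of_le_of_lt hx ((ENNReal.ofReal_lt_ofReal_iff hδ).2 hρ)
  obtain ⟨l', hl', p, -, hp⟩ := reachWithin_of_dIn_lt h1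
  cases p with
  | nil => rfl
  | cons h p =>
    have h2 := walkWeight_nonneg (fun u v huv => hδ.trans_le (hw u v huv)) p
    have h3 := hw _ _ h
    rw [walkWeight_cons] at hp
    linarith

/-- Parameters for the truncated geometric radii. -/
lemma exists_parameters {r : ℕ} (hr : 1 ≤ r) {Δ δ : ℝ} (hΔ : 0 < Δ) (hδ : 0 < δ) :
    ∃ N : ℕ, 0 < N ∧ Δ / (2 * N) ≤ δ ∧ 9 / 10 ≤ exp (-(20 * r / Δ * (Δ / (2 * N)))) ∧
      exp (-(20 * r / Δ * (Δ / (2 * N)))) < 1 ∧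
      exp (-(20 * r / Δ * (Δ / (2 * N)))) ^ N ≤ (1 / 8) ^ r / 100 := by
  obtain ⟨N, hN⟩ := exists_nat_ge (100 * r + Δ / δ)
  have hr' : (1 : ℝ) ≤ r := by exact_mod_cast hr
  have hq : 0 < Δ / δ := by positivity
  have hN0 : (0 : ℝ) < N := by linarith
  have e : 20 * r / Δ * (Δ / (2 * N)) = 10 * r / N := by field_simp; ring
  have e0 : (0 : ℝ) < 10 * r / N := by positivity
  refine ⟨N, by exact_mod_cast hN0, ?_, ?_⟩
  · rw [div_le_iff₀ (by positivity)]
    have : Δ / δ ≤ N := by linarith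
    rw [div_le_iff₀ hδ] at this
    nlinarith
  rw [e]
  refine ⟨?_, ?_, ?_⟩
  · have h1 := add_one_le_exp (-(10 * r / N : ℝ))
    have h2 : (10 * r / N : ℝ) ≤ 1 / 10 := by
      rw [div_le_iff₀ hN0]; linarith
    linarith
  · exact exp_lt_one_iff.2 (by linarith)
  · rw [← exp_nat_mul]
    have : (N : ℝ) * -(10 * r / N) = r * (-10) := by field_simp
    rw [this, exp_nat_mul]
    have h1 : exp (-10) ≤ 1 / 8 * (1 / 100) := by
      have h2 : (800 : ℝ) ≤ exp 10 := by
        have h3 : (2 : ℝ) ≤ exp 1 := by linarith [add_one_le_exp (1 : ℝ)]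
        calc (800 : ℝ) ≤ 2 ^ 10 := by norm_num
          _ ≤ exp 1 ^ 10 := pow_le_pow_left₀ (by norm_num) h3 10
          _ = exp 10 := by rw [← exp_nat_mul]; norm_num
      rw [exp_neg]
      calc (exp 10)⁻¹ ≤ (800 : ℝ)⁻¹ := inv_anti₀ (by norm_num) h2
        _ = _ := by norm_num
    calc exp (-10) ^ r ≤ (1 / 8 * (1 / 100)) ^ r := pow_le_pow_left₀ (exp_pos _).le h1 r
      _ = (1 / 8) ^ r * (1 / 100) ^ r := mul_pow _ _ _
      _ ≤ (1 / 8) ^ r * (1 / 100) := mul_le_mul_of_nonneg_left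
          (pow_le_of_le_one (by norm_num) (by norm_num) (by omega)) (by positivity)
      _ = _ := by ring

end CutProbability

/-- Section 6: strong-diameter partitions for bounded-treewidth graphs.
There is a universal constant `C` such that: for every `r ≥ 1`, every finite
edge-weighted graph `G` of treewidth at most `r - 1` and every `Δ > 0` there is a
distribution over partitions of `V` (encoded by cluster-labelling functions `f : V → ℕ`)
whose clusters have strong diameter at most `Δ`, such that for every vertex `z` and
every `0 ≤ γ ≤ 1/r`, the probability that the ball `B_G(z, γΔ)` is cut is at most
`C·γ·r`. -/
theorem treewidth_partition_cut_probability :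
    ∃ C : ℝ, 0 < C ∧
      ∀ (r : ℕ), 1 ≤ r →
      ∀ (V : Type) (_ : Fintype V) (G : SimpleGraph V) (w : V → V → ℝ),
        (∀ u v, G.Adj u v → 0 < w u v) → (∀ u v, w u v = w v u) →
        TreewidthAtMost G (r - 1) →
        ∀ Δ : ℝ, 0 < Δ →
        ∃ μ : PMF (V → ℕ),
          (∀ f ∈ μ.support, ∀ x y : V, f x = f y →
            dIn G w {v | f v = f x} x y ≤ ENNReal.ofReal Δ) ∧
          ∀ (z : V) (γ : ℝ), 0 ≤ γ → γ ≤ 1 / (r : ℝ) →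
            μ.toOuterMeasure {f | ¬ gball G w z (γ * Δ) ⊆ {y | f y = f z}} ≤
              ENNReal.ofReal (C * γ * (r : ℝ)) := by
  refine ⟨1200, by norm_num, ?_⟩
  intro r hr V _ G w hpos hsymm htw Δ hΔ
  obtain ⟨l, hnd, hl, hwidth⟩ := exists_elimination_order htw
  obtain ⟨δ, hδ, hδw⟩ := exists_weight_lower_bound hpos
  obtain ⟨N, hN0, hNδ, hu, hu1, huN⟩ := exists_parameters hr hΔ hδ
  have hr' : (1 : ℝ) ≤ r := by exact_mod_cast hr
  have hN0' : (0 : ℝ) < N := by exact_mod_cast hN0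
  set μ : ℝ := 20 * r / Δ with hμ
  set ε : ℝ := Δ / (2 * N) with hε
  set u : ℝ := exp (-(μ * ε)) with hue
  have hμ0 : 0 < μ := by positivity
  have hε0 : 0 < ε := by positivity
  have hu0 : 0 < u := exp_pos _
  have hq0 : 0 ≤ u ^ 3 := by positivity
  have hq1 : u ^ 3 < 1 := pow_lt_one₀ hu0.le hu1 (by norm_num)
  have hqN : (u ^ 3) ^ N ≠ 1 := (pow_lt_one₀ hq0 hq1 hN0.ne').ne
  let ν : PMF (Fin N) := PMF.ofFintype (fun g => ENNReal.ofReal (geomWeight (u ^ 3) N g)) (by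
    rw [← ENNReal.ofReal_sum_of_nonneg fun (g : Fin N) _ => geomWeight_nonneg hq0 hq1.le g,
      ← Finset.sum_range (fun g => geomWeight (u ^ 3) N g), sum_range_geomWeight hqN,
      ENNReal.ofReal_one])
  refine ⟨ballCarving G w ε ν l Set.univ, fun f hf x y hxy => ?_, fun z γ hγ _ => ?_⟩
  · have h1 := (ballCarving_diameter hpos hsymm hε0.le ν l Set.univ (fun x _ => hl x) hf
      (Set.mem_univ x) (Set.mem_univ y) hxy).dIn_le
    have h2 : 2 * (N * ε) = Δ := by rw [hε]; field_simp
    simpa [h2] using h1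
  · have hρ0 : 0 ≤ γ * Δ := by positivity
    rcases lt_or_ge (γ * Δ) δ with hρδ | hρδ
    · have : {f : V → ℕ | ¬ gball G w z (γ * Δ) ⊆ {y | f y = f z}} = ∅ := by
        refine Set.eq_empty_iff_forall_notMem.2 fun f hf => hf fun x hx => ?_
        have := gball_subset_singleton hδ hδw z hρδ hx
        rw [Set.mem_singleton_iff.1 this]
        rfl
      rw [this, measure_empty]
      exact zero_le
    rcases le_or_gt 1 (1200 * γ * r) with hbig | hsmall
    · refine (toOuterMeasure_le_one _ _).trans ?_
      rw [← ENNReal.ofReal_one]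
      exact ENNReal.ofReal_le_ofReal hbig
    have hρpos : 0 < γ * Δ := hδ.trans_le hρδ
    set B := cluster G w Set.univ z (2 * (γ * Δ)) with hB
    have hzB : z ∈ B := ReachWithin.refl (Set.mem_univ z) (by linarith)
    have hgB : gball G w z (γ * Δ) ⊆ B := by
      intro x hx
      have : dIn G w Set.univ z x < ENNReal.ofReal (2 * (γ * Δ)) :=
        lt_of_le_of_lt hx ((ENNReal.ofReal_lt_ofReal_iff (by linarith)).2 (by linarith))
      obtain ⟨l', hl', h⟩ := reachWithin_of_dIn_lt this
      exact h.mono subset_rfl hl'.le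
    have hBU : ∀ U, B ⊆ U → ∀ x ∈ B, ReachWithin G w U (2 * (γ * Δ)) z x := fun U hU x hx =>
      (ReachWithin.in_cluster hpos hx).mono hU le_rfl
    have hμΔ : μ * (γ * Δ) = 20 * (γ * r) := by rw [hμ]; field_simp
    have hμρ : μ * (2 * (γ * Δ)) ≤ 1 := by linarith
    set t := ⌈2 * (2 * (γ * Δ)) / ε⌉₊ with ht
    have ht1 : 2 * (2 * (γ * Δ)) ≤ t * ε := (div_le_iff₀ hε0).1 (Nat.le_ceil _)
    have ht2 : t * ε ≤ 5 * (γ * Δ) := by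
      have h1 := Nat.ceil_lt_add_one (by positivity : 0 ≤ 2 * (2 * (γ * Δ)) / ε)
      have h2 := mul_le_mul_of_nonneg_right h1.le hε0.le
      rw [add_mul, div_mul_cancel₀ _ hε0.ne'] at h2
      linarith
    have hmain := ballCarving_cut_le (C := fun _ => ∅) (y := fun _ => 0) (U := Set.univ) hpos hsymm
      hμ0.le hε0.le (by linarith) hμρ ht1 hr hue hu hu1 huN (ν := ν) (fun g => rfl) hBU hzB l
      (fun l' hl' hz => by have := hwidth l' hl' z hz; omega) hnd (fun x _ => hl x)
      (Set.subset_univ _)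
      { disjoint_left := by simp
        disjoint := by simp
        nonneg := by simp
        root := by simp
        linked := by simp }
    refine (measure_mono ?_).trans (hmain.trans (ENNReal.ofReal_le_ofReal ?_))
    · intro f hf
      obtain ⟨x, hx, hne⟩ := Set.not_subset.1 hf
      exact ⟨x, hgB hx, hne⟩
    · have h1 : 1 - (u ^ 3) ^ t ≤ 300 * (γ * r) := by
        have h2 : (u ^ 3) ^ t = exp (-(3 * (t * (μ * ε)))) := by
          rw [hue, ← pow_mul, ← exp_nat_mul]
          congr 1
          push_cast
          ring
        have h3 := add_one_le_exp (-(3 * (t * (μ * ε))))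
        have h4 := mul_le_mul_of_nonneg_left ht2 hμ0.le
        rw [h2]
        linarith
      have h2 : u ^ N * (3 * u⁻¹ ^ N) = 3 := by
        rw [inv_pow]
        field_simp
      simp only [mul_zero, Finset.sum_const_zero, sub_zero, h2]
      linarith

end KPRpaper
end

section
/- Let 0 ≤ l < u, b > 0, and set b̄ = b/(u−l). Let R be a random variable with density f(y) = b̄·e^{−b̄y}/(e^{−b̄l} − e^{−b̄u}) on [l,u]. Let γ > 0, let ρ ≥ 0 with ρ ≤ u, and set m = max{l, ρ} and δ = e^{−2b̄γ}. Then Pr[m ≤ R < ρ + 2γ] ≤ (1 − δ)·(Pr[R ≥ m] + 1/(e^b − 1)). -/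
open MeasureTheory Real

namespace KPRpaper

theorem integral_mul_exp_neg_mul_div (c D x y : ℝ) :
    ∫ t in x..y, c * Real.exp (-c * t) / D =
      (Real.exp (-c * x) - Real.exp (-c * y)) / D := by
  have hderiv : ∀ t ∈ Set.uIcc x y,
      HasDerivAt (fun t => -Real.exp (-c * t) / D) (c * Real.exp (-c * t) / D) t := by
    intro t _
    have h : HasDerivAt (fun t => -c * t) (-c) t := by
      simpa using (hasDerivAt_id t).const_mul (-c)
    exact (h.exp.fun_neg.div_const D).congr_deriv (by ring)
  rw [intervalIntegral.integral_eq_sub_of_hasDerivAt hderiv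
    (Continuous.intervalIntegrable (by fun_prop) _ _)]
  ring

theorem setIntegral_Icc_mul_exp_neg_mul_div (c D : ℝ) {x y : ℝ} (hxy : x ≤ y) :
    ∫ t in Set.Icc x y, c * Real.exp (-c * t) / D =
      (Real.exp (-c * x) - Real.exp (-c * y)) / D := by
  rw [integral_Icc_eq_integral_Ioc, ← intervalIntegral.integral_of_le hxy,
    integral_mul_exp_neg_mul_div]

/-- Claim B.1 / `claim:cut` in the proof of Lemma 3.4.
Let `0 ≤ l < u`, `b > 0`, `b̄ = b/(u-l)`, and let `R` have the truncated exponential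
density `f(y) = b̄·e^{-b̄y}/(e^{-b̄l} - e^{-b̄u})` on `[l,u]`.  Let `γ > 0`,
`0 ≤ ρ ≤ u`, `m = max l ρ` and `δ = e^{-2b̄γ}`.  Then
`Pr[m ≤ R < ρ + 2γ] ≤ (1-δ)·(Pr[R ≥ m] + 1/(e^b - 1))`, the probabilities being
integrals of the density over the corresponding subsets of `[l,u]`. -/
theorem truncated_exponential_cut_bound
    (l u b γ ρ : ℝ) (hl : 0 ≤ l) (hlu : l < u) (hb : 0 < b)
    (hγ : 0 < γ) (hρ0 : 0 ≤ ρ) (hρu : ρ ≤ u) :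
    (∫ y in Set.Icc l u ∩ Set.Ico (max l ρ) (ρ + 2 * γ),
        (b / (u - l)) * Real.exp (-(b / (u - l)) * y) /
          (Real.exp (-(b / (u - l)) * l) - Real.exp (-(b / (u - l)) * u))) ≤
      (1 - Real.exp (-2 * (b / (u - l)) * γ)) *
        ((∫ y in Set.Icc l u ∩ Set.Ici (max l ρ),
            (b / (u - l)) * Real.exp (-(b / (u - l)) * y) /
              (Real.exp (-(b / (u - l)) * l) - Real.exp (-(b / (u - l)) * u))) +
          1 / (Real.exp b - 1)) := by
  have hul : 0 < u - l := sub_pos.2 hlu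
  set c := b / (u - l) with hc
  have hc0 : 0 < c := div_pos hb hul
  have hbc : b = c * (u - l) := by rw [hc]; field_simp
  set D := Real.exp (-c * l) - Real.exp (-c * u) with hD
  have hD0 : 0 < D := sub_pos.2 (Real.exp_lt_exp.2 (by nlinarith))
  set m := max l ρ with hm
  have hmu : m ≤ u := max_le hlu.le hρu
  have hset : Set.Icc l u ∩ Set.Ici m = Set.Icc m u := by
    ext y
    simp only [Set.mem_inter_iff, Set.mem_Icc, Set.mem_Ici]
    exact ⟨fun h => ⟨h.2, h.1.2⟩, fun h => ⟨⟨(le_max_left l ρ).trans h.1, h.2⟩, h.1⟩⟩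
  have htail : 1 / (Real.exp b - 1) = Real.exp (-c * u) / D := by
    have hmul : Real.exp b * Real.exp (-c * u) = Real.exp (-c * l) := by
      rw [← Real.exp_add, hbc]
      congr 1
      ring
    have hb1 : 0 < Real.exp b - 1 := sub_pos.2 (Real.one_lt_exp_iff.2 hb)
    rw [div_eq_div_iff hb1.ne' hD0.ne', hD, ← hmul]
    ring
  have hshift : Real.exp (-c * (m + 2 * γ)) = Real.exp (-c * m) * Real.exp (-2 * c * γ) := by
    rw [← Real.exp_add]
    congr 1
    ring
  have hsub : Set.Icc l u ∩ Set.Ico m (ρ + 2 * γ) ⊆ Set.Icc m (m + 2 * γ) := fun y hy =>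
    ⟨hy.2.1, by linarith [hy.2.2, le_max_right l ρ]⟩
  calc
    _ ≤ ∫ y in Set.Icc m (m + 2 * γ), c * Real.exp (-c * y) / D :=
      setIntegral_mono_set
        (Continuous.integrableOn_Icc (by fun_prop))
        (Filter.Eventually.of_forall fun y => by
          change 0 ≤ c * Real.exp (-c * y) / D
          positivity)
        hsub.eventuallyLE
    _ = _ := by
      rw [hset, setIntegral_Icc_mul_exp_neg_mul_div c D hmu,
        setIntegral_Icc_mul_exp_neg_mul_div c D (by linarith), htail, hshift]
      ring

end KPRpaper
end
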